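/- arXiv:1704.08705 — 8 statements merged into one kernel-verified Lean document; each statement's English description precedes it below -/
import Mathlib

section
/- Universal balancing theorem (combinatorial form of Theorem 5.2): For every ranked alphabet Σ there is a constant C (depending only on Σ) such that for every term t ∈ T(Σ) of size n ≥ 2 there exists a tree straight-line program G over Σ in normal form with val(G) = t, of size at most C·n/log₂ n and of depth at most C·log₂ n. -/
/-- Terms over a ranked alphabet `σ` with arity function `ar`. -/
inductive RTerm (σ : Type) (ar : σ → ℕ) : Type
  | node (f : σ) (args : Fin (ar f) → RTerm σ ar) : RTerm σ ar

/-- The size of a term: its number of nodes. -/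
def RTerm.size {σ : Type} {ar : σ → ℕ} : RTerm σ ar → ℕ
  | .node _ args => 1 + Finset.univ.sum fun i => (args i).size

/-- Insert `x` at position `i` into an `(r-1)`-tuple, producing an `r`-tuple. -/
def plugAt {A : Type} {r : ℕ} (i : Fin r) (ts : Fin (r - 1) → A) (x : A)
    (j : Fin r) : A :=
  if h : (j : ℕ) < (i : ℕ) then ts ⟨j, by omega⟩
  else if h' : (j : ℕ) = (i : ℕ) then x
  else ts ⟨(j : ℕ) - 1, by have := j.isLt; omega⟩

/-- The result `f(t₁, …, t_{i-1}, s, t_i, …, t_{r-1})` of plugging the term `s`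
into the hole of the context `f(t₁, …, t_{i-1}, x, t_i, …, t_{r-1})`. -/
def RTerm.plug {σ : Type} {ar : σ → ℕ} (f : σ) (i : Fin (ar f))
    (ts : Fin (ar f - 1) → RTerm σ ar) (s : RTerm σ ar) : RTerm σ ar :=
  RTerm.node f (plugAt i ts s)

/-- The right-hand side of a production of a tree straight-line program in
normal form over the nonterminal set `N`:
`A → f(A₁,…,A_r)`, `A(x) → f(A₁,…,A_{i−1},x,A_{i+1},…,A_r)`, `A → B(C)`, or
`A(x) → B(C(x))`. -/
inductive Rhs (σ : Type) (ar : σ → ℕ) (N : Type) : Type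
  | base0 (f : σ) (args : Fin (ar f) → N) : Rhs σ ar N
  | base1 (f : σ) (i : Fin (ar f)) (args : Fin (ar f - 1) → N) : Rhs σ ar N
  | sub (B C : N) : Rhs σ ar N
  | comp (B C : N) : Rhs σ ar N

/-- `B` occurs in the right-hand side `r`. -/
def Rhs.Occurs {σ : Type} {ar : σ → ℕ} {N : Type} (B : N) : Rhs σ ar N → Prop
  | .base0 _ args => ∃ i, args i = B
  | .base1 _ _ args => ∃ i, args i = B
  | .sub B' C' => B = B' ∨ B = C'
  | .comp B' C' => B = B' ∨ B = C'

/-- The ranks (`false` = rank 0, `true` = rank 1) of the nonterminals are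
respected by the production `A → r`: a rank-0 nonterminal has a production
`A → f(A₁,…,A_r)` or `A → B(C)`, a rank-1 nonterminal a production
`A(x) → f(A₁,…,x,…,A_r)` or `A(x) → B(C(x))`, and the referenced nonterminals
have the appropriate ranks. -/
def RankOk {σ : Type} {ar : σ → ℕ} {N : Type} (rank : N → Bool) (A : N) :
    Rhs σ ar N → Prop
  | .base0 _ args => rank A = false ∧ ∀ i, rank (args i) = false
  | .base1 _ _ args => rank A = true ∧ ∀ i, rank (args i) = false
  | .sub B C => rank A = false ∧ rank B = true ∧ rank C = false
  | .comp B C => rank A = true ∧ rank B = true ∧ rank C = true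

/-- `val0` (values of rank-0 nonterminals: terms) and `val1` (values of rank-1
nonterminals: the linear term functions of the derived contexts) are consistent
with the production `A → r`. -/
def ValOk {σ : Type} {ar : σ → ℕ} {N : Type}
    (val0 : N → RTerm σ ar) (val1 : N → RTerm σ ar → RTerm σ ar) (A : N) :
    Rhs σ ar N → Prop
  | .base0 f args => val0 A = RTerm.node f fun i => val0 (args i)
  | .base1 f i args => val1 A = RTerm.plug f i fun j => val0 (args j)
  | .sub B C => val0 A = val1 B (val0 C)
  | .comp B C => val1 A = fun s => val1 B (val1 C s)


namespace Bal

variable {σ : Type} {ar : σ → ℕ}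

/-- One spine step of a context. -/
structure Step (σ : Type) (ar : σ → ℕ) : Type where
  f : σ
  i : Fin (ar f)
  args : Fin (ar f - 1) → RTerm σ ar

def Step.app (s : Step σ ar) : RTerm σ ar → RTerm σ ar := RTerm.plug s.f s.i s.args

def Step.size (s : Step σ ar) : ℕ := 1 + ∑ j, (s.args j).size

/-- the context (as a function) described by a list of spine steps -/
def app : List (Step σ ar) → RTerm σ ar → RTerm σ ar
  | [] => id
  | s :: l => fun x => s.app (app l x)

def csize : List (Step σ ar) → ℕ
  | [] => 0
  | s :: l => s.size + csize l

lemma app_append (a b : List (Step σ ar)) : app (a ++ b) = fun x => app a (app b x) := by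
  induction a with
  | nil => rfl
  | cons s l ih => simp [app, ih]

lemma csize_append (a b : List (Step σ ar)) : csize (a ++ b) = csize a + csize b := by
  induction a with
  | nil => simp [csize]
  | cons s l ih => simp [csize, ih]; omega

lemma csize_pos {a : List (Step σ ar)} (h : a ≠ []) : 0 < csize a := by
  cases a with
  | nil => exact absurd rfl h
  | cons s l => simp [csize, Step.size]

lemma size_node (f : σ) (args : Fin (ar f) → RTerm σ ar) :
    (RTerm.node f args).size = 1 + ∑ i, (args i).size := by
  simp [RTerm.size]

lemma size_pos (t : RTerm σ ar) : 0 < t.size := by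
  cases t; rw [size_node]; omega

/-- Values of nonterminals: terms or contexts. -/
abbrev V (σ : Type) (ar : σ → ℕ) : Type := RTerm σ ar ⊕ (RTerm σ ar → RTerm σ ar)

/-- `v` is derivable with depth at most `d` using only values in `S`. -/
inductive Der (S : Set (V σ ar)) : ℕ → V σ ar → Prop
  | base0 (d : ℕ) (f : σ) (args : Fin (ar f) → RTerm σ ar)
      (hm : Sum.inl (RTerm.node f args) ∈ S)
      (h : ∀ i, Der S d (Sum.inl (args i))) : Der S (d + 1) (Sum.inl (RTerm.node f args))
  | base1 (d : ℕ) (f : σ) (i : Fin (ar f)) (args : Fin (ar f - 1) → RTerm σ ar)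
      (hm : Sum.inr (RTerm.plug f i args) ∈ S)
      (h : ∀ i, Der S d (Sum.inl (args i))) : Der S (d + 1) (Sum.inr (RTerm.plug f i args))
  | sub (d : ℕ) (B : RTerm σ ar → RTerm σ ar) (t : RTerm σ ar)
      (hm : Sum.inl (B t) ∈ S) (hB : Der S d (Sum.inr B)) (ht : Der S d (Sum.inl t)) :
      Der S (d + 1) (Sum.inl (B t))
  | comp (d : ℕ) (B B' : RTerm σ ar → RTerm σ ar)
      (hm : Sum.inr (fun x => B (B' x)) ∈ S) (hB : Der S d (Sum.inr B))
      (hB' : Der S d (Sum.inr B')) :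
      Der S (d + 1) (Sum.inr (fun x => B (B' x)))

lemma Der.mem {S : Set (V σ ar)} {d : ℕ} {v : V σ ar} (h : Der S d v) : v ∈ S := by
  cases h <;> assumption

lemma Der.mono {S S' : Set (V σ ar)} (hS : S ⊆ S') {d : ℕ} {v : V σ ar} (h : Der S d v) :
    ∀ d', d ≤ d' → Der S' d' v := by
  induction h with
  | base0 d f args hm h ih =>
    intro d' hd
    obtain ⟨e, rfl⟩ : ∃ e, d' = e + 1 := ⟨d' - 1, by omega⟩
    exact .base0 e f args (hS hm) fun i => ih i e (by omega)
  | base1 d f i args hm h ih =>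
    intro d' hd
    obtain ⟨e, rfl⟩ : ∃ e, d' = e + 1 := ⟨d' - 1, by omega⟩
    exact .base1 e f i args (hS hm) fun i => ih i e (by omega)
  | sub d B t hm hB ht ihB iht =>
    intro d' hd
    obtain ⟨e, rfl⟩ : ∃ e, d' = e + 1 := ⟨d' - 1, by omega⟩
    exact .sub e B t (hS hm) (ihB e (by omega)) (iht e (by omega))
  | comp d B B' hm hB ht ihB iht =>
    intro d' hd
    obtain ⟨e, rfl⟩ : ∃ e, d' = e + 1 := ⟨d' - 1, by omega⟩
    exact .comp e B B' (hS hm) (ihB e (by omega)) (iht e (by omega))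

/-- Values of small terms and contexts. -/
def Small (σ : Type) (ar : σ → ℕ) (K : ℕ) : Set (V σ ar) :=
  (Sum.inl '' {t : RTerm σ ar | t.size ≤ K}) ∪
    ((fun l => Sum.inr (app l)) '' {l : List (Step σ ar) | csize l ≤ K})

lemma small_term (K : ℕ) (t : RTerm σ ar) (h : t.size ≤ K) :
    Der (Small σ ar K) t.size (Sum.inl t) := by
  induction t with
  | node f args ih =>
    have hs := size_node f args
    have key : ∀ i, (args i).size ≤ ∑ i, (args i).size := fun i =>
      Finset.single_le_sum (f := fun i => (args i).size) (fun _ _ => Nat.zero_le _)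
        (Finset.mem_univ i)
    rw [hs, add_comm]
    refine .base0 _ f args (Or.inl ⟨_, h, rfl⟩) fun i => ?_
    exact (ih i (by have := key i; omega)).mono subset_rfl _ (key i)

lemma small_ctx (K : ℕ) (l : List (Step σ ar)) (hl : l ≠ []) (h : csize l ≤ K) :
    Der (Small σ ar K) (csize l) (Sum.inr (app l)) := by
  induction l with
  | nil => exact absurd rfl hl
  | cons s l ih =>
    have key : ∀ i, (s.args i).size ≤ ∑ i, (s.args i).size := fun i =>
      Finset.single_le_sum (f := fun i => (s.args i).size) (fun _ _ => Nat.zero_le _)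
        (Finset.mem_univ i)
    have hc : csize (s :: l) = s.size + csize l := rfl
    have hss : s.size = 1 + ∑ i, (s.args i).size := rfl
    have h1 : Der (Small σ ar K) s.size (Sum.inr s.app) := by
      rw [hss, add_comm]
      refine .base1 _ s.f s.i s.args (Or.inr ⟨[s], ?_, rfl⟩) fun i => ?_
      · show csize [s] ≤ K
        simp only [csize]; omega
      · exact (small_term K _ (by have := key i; omega)).mono subset_rfl _ (key i)
    by_cases hl' : l = []
    · subst hl'
      exact h1
    · have h2 := ih hl' (by omega)
      have := csize_pos hl'
      obtain ⟨e, he⟩ : ∃ e, csize (s :: l) = e + 1 := ⟨csize (s :: l) - 1, by omega⟩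
      rw [he]
      exact .comp e s.app (app l) (Or.inr ⟨s :: l, h, rfl⟩)
        (h1.mono subset_rfl _ (by omega)) (h2.mono subset_rfl _ (by omega))

/-! ### counting -/

abbrev Tok (σ : Type) (ar : σ → ℕ) : Type := σ ⊕ ((f : σ) × Fin (ar f))

def enc : RTerm σ ar → List (Tok σ ar)
  | .node f args => Sum.inl f :: (List.ofFn fun i => enc (args i)).flatten

def encC : List (Step σ ar) → List (Tok σ ar)
  | [] => []
  | s :: l => Sum.inr ⟨s.f, s.i⟩ :: ((List.ofFn fun i => enc (s.args i)).flatten ++ encC l)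

lemma enc_len_aux {r : ℕ} (u : Fin r → RTerm σ ar) (h : ∀ i, (enc (u i)).length = (u i).size) :
    ((List.ofFn fun i => enc (u i)).flatten).length = ∑ i, (u i).size := by
  induction r with
  | zero => simp
  | succ r ih =>
    rw [List.ofFn_succ, List.flatten_cons, List.length_append, Fin.sum_univ_succ, h,
      ih (fun i => u i.succ) (fun i => h i.succ)]

lemma enc_len (t : RTerm σ ar) : (enc t).length = t.size := by
  induction t with
  | node f args ih =>
    rw [size_node, enc, List.length_cons, enc_len_aux args ih, add_comm]

lemma encC_len (l : List (Step σ ar)) : (encC l).length = csize l := by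
  induction l with
  | nil => rfl
  | cons s l ih =>
    rw [encC, List.length_cons, List.length_append, enc_len_aux _ (fun i => enc_len _), ih, csize,
      Step.size]
    omega

lemma enc_inj_aux {r : ℕ} (u v : Fin r → RTerm σ ar)
    (h : ∀ i, ∀ t' a b, enc (u i) ++ a = enc t' ++ b → u i = t' ∧ a = b) :
    ∀ a b, (List.ofFn fun i => enc (u i)).flatten ++ a = (List.ofFn fun i => enc (v i)).flatten ++ b
      → u = v ∧ a = b := by
  induction r with
  | zero => intro a b hab; exact ⟨Subsingleton.elim _ _, by simpa using hab⟩
  | succ r ih =>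
    intro a b hab
    rw [List.ofFn_succ, List.ofFn_succ, List.flatten_cons, List.flatten_cons, List.append_assoc,
      List.append_assoc] at hab
    obtain ⟨h0, h1⟩ := h 0 _ _ _ hab
    obtain ⟨h2, h3⟩ := ih (fun i => u i.succ) (fun i => v i.succ) (fun i => h i.succ) _ _ h1
    refine ⟨?_, h3⟩
    funext i
    refine Fin.cases h0 (fun j => congrFun h2 j) i

lemma enc_inj (t : RTerm σ ar) : ∀ t' a b, enc t ++ a = enc t' ++ b → t = t' ∧ a = b := by
  induction t with
  | node f args ih =>
    rintro ⟨f', args'⟩ a b h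
    simp only [enc, List.cons_append, List.cons.injEq, Sum.inl.injEq] at h
    obtain ⟨rfl, h⟩ := h
    obtain ⟨rfl, h'⟩ := enc_inj_aux args args' ih a b h
    exact ⟨rfl, h'⟩

lemma encC_inj (l : List (Step σ ar)) : ∀ l', encC l = encC l' → l = l' := by
  induction l with
  | nil => rintro (_ | ⟨s, l⟩) h
           · rfl
           · simp [encC] at h
  | cons s l ih =>
    rintro (_ | ⟨s', l'⟩) h
    · simp [encC] at h
    · obtain ⟨f, i, u⟩ := s
      obtain ⟨f', i', u'⟩ := s'
      simp only [encC, List.cons.injEq, Sum.inr.injEq, Sigma.mk.injEq] at h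
      obtain ⟨⟨rfl, hi⟩, h⟩ := h
      obtain rfl := eq_of_heq hi
      obtain ⟨rfl, h'⟩ := enc_inj_aux u u' (fun i => enc_inj _) _ _ h
      rw [ih _ h']

lemma count_lists {α τ : Type} [Fintype τ] (K : ℕ) (e : α → List τ) (he : Function.Injective e) :
    {x | (e x).length ≤ K}.Finite ∧ {x | (e x).length ≤ K}.ncard ≤ (Fintype.card τ + 1) ^ K := by
  classical
  let g : α → (Fin K → Option τ) := fun x i => (e x)[(i : ℕ)]?
  have hg : Set.InjOn g {x | (e x).length ≤ K} := by
    intro x hx y hy hxy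
    apply he
    apply List.ext_getElem?
    intro i
    by_cases hi : i < K
    · exact congrFun hxy ⟨i, hi⟩
    · simp only [Set.mem_setOf_eq] at hx hy
      rw [List.getElem?_eq_none (by omega), List.getElem?_eq_none (by omega)]
  constructor
  · exact Set.Finite.of_finite_image (Set.toFinite _) hg
  · rw [← Set.ncard_image_of_injOn hg]
    refine (Set.ncard_le_card _).trans ?_
    simp

lemma small_card [Fintype σ] (K : ℕ) : (Small σ ar K).Finite ∧
    (Small σ ar K).ncard ≤ 2 * (Fintype.card (Tok σ ar) + 1) ^ K := by
  have h1 := count_lists (τ := Tok σ ar) K (enc (σ := σ) (ar := ar))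
    (fun t t' h => (enc_inj t t' [] [] (by simp [h])).1)
  have h2 := count_lists (τ := Tok σ ar) K (encC (σ := σ) (ar := ar)) (fun l l' h => encC_inj l l' h)
  simp only [enc_len, encC_len] at h1 h2
  refine ⟨(h1.1.image _).union (h2.1.image _), ?_⟩
  refine (Set.ncard_union_le _ _).trans ?_
  have h3 := Set.ncard_image_le (f := (Sum.inl : _ → V σ ar)) h1.1
  have h4 := Set.ncard_image_le (f := fun l => (Sum.inr (app l) : V σ ar)) h2.1
  have := h1.2
  have := h2.2
  omega

/-! ### splitting -/

lemma exists_rest {A : Type} {r : ℕ} (i : Fin r) (g : Fin r → A) :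
    ∃ rest : Fin (r - 1) → A, plugAt i rest (g i) = g ∧
      ∀ s : A → ℕ, ∑ j, s (rest j) + s (g i) = ∑ k, s (g k) := by
  cases r with
  | zero => exact i.elim0
  | succ r =>
    refine ⟨fun j => g (i.succAbove j), ?_, ?_⟩
    · funext j
      unfold plugAt
      split_ifs with h h'
      · refine congrArg g ?_
        rw [Fin.succAbove_of_castSucc_lt]
        · rfl
        · exact h
      · congr 1
        ext; exact h'.symm
      · refine congrArg g ?_
        rw [Fin.succAbove_of_le_castSucc]
        · ext; simp; omega
        · rw [Fin.le_def]; simp; omega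
    · intro s
      rw [Fin.sum_univ_succAbove _ i, add_comm]
      rfl

lemma split_term (M : ℕ) (t : RTerm σ ar) (h : M < 2 * t.size) :
    ∃ (l : List (Step σ ar)) (f : σ) (args : Fin (ar f) → RTerm σ ar),
      t = app l (RTerm.node f args) ∧ t.size = csize l + (RTerm.node f args).size ∧
      M < 2 * (RTerm.node f args).size ∧ ∀ i, 2 * (args i).size ≤ M := by
  induction t with
  | node f args ih =>
    by_cases hc : ∀ i, 2 * (args i).size ≤ M
    · exact ⟨[], f, args, rfl, by simp [csize], h, hc⟩
    · push Not at hc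
      obtain ⟨i, hi⟩ := hc
      obtain ⟨l, f', args', h1, h2, h3, h4⟩ := ih i hi
      obtain ⟨rest, hr, hs⟩ := exists_rest i args
      refine ⟨⟨f, i, rest⟩ :: l, f', args', ?_, ?_, h3, h4⟩
      · simp only [app, Step.app, RTerm.plug]
        rw [← h1, hr]
      · have := hs RTerm.size
        rw [size_node]
        simp only [csize, Step.size]
        omega

lemma split_list (l : List (Step σ ar)) : ∀ b, b < csize l →
    ∃ s1 st s2, l = s1 ++ st :: s2 ∧ csize s1 ≤ b ∧ b < csize s1 + st.size := by
  induction l with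
  | nil => intro b hb; simp [csize] at hb
  | cons s l ih =>
    intro b hb
    by_cases h : b < s.size
    · exact ⟨[], s, l, rfl, by simp [csize], by simpa [csize] using h⟩
    · simp only [csize] at hb
      obtain ⟨s1, st, s2, rfl, h1, h2⟩ := ih (b - s.size) (by omega)
      exact ⟨s :: s1, st, s2, rfl, by simp only [csize]; omega, by simp only [csize]; omega⟩

/-! ### cost functions -/

def g0 (K m : ℕ) : ℕ := if m ≤ K then 0 else 10 * m - 8 * K
def g1 (K m : ℕ) : ℕ := if m ≤ K then 0 else 10 * m - 5 * K

lemma sum_g0 {ι : Type} (K : ℕ) (u : ι → ℕ) (s : Finset ι) :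
    (∑ i ∈ s, g0 K (u i) = 0) ∨
    (∃ i ∈ s, ∑ i ∈ s, g0 K (u i) = 10 * u i - 8 * K ∧ K < u i ∧ u i ≤ ∑ i ∈ s, u i) ∨
    (∑ i ∈ s, g0 K (u i) + 16 * K ≤ 10 * ∑ i ∈ s, u i) := by
  classical
  induction s using Finset.induction_on with
  | empty => simp
  | insert a s ha ih =>
    rw [Finset.sum_insert ha, Finset.sum_insert ha]
    by_cases h : u a ≤ K
    · have hz : g0 K (u a) = 0 := if_pos h
      rw [hz]
      rcases ih with h1 | ⟨i, hi, h1, h2, h3⟩ | h1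
      · left; omega
      · right; left; exact ⟨i, Finset.mem_insert_of_mem hi, by omega, h2, by omega⟩
      · right; right; omega
    · have hz : g0 K (u a) = 10 * u a - 8 * K := if_neg h
      rw [hz]
      rcases ih with h1 | ⟨i, hi, h1, h2, h3⟩ | h1
      · right; left; exact ⟨a, Finset.mem_insert_self _ _, by omega, by omega, by omega⟩
      · right; right; omega
      · right; right; omega

lemma arith0 {ι : Type} [Fintype ι] (K c m : ℕ) (u : ι → ℕ) (hm : K < m)
    (hsum : m = c + (1 + ∑ i, u i)) (hc : 2 * c ≤ m) (hu : ∀ i, 2 * u i ≤ m) :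
    2 * K + g1 K c + ∑ i, g0 K (u i) ≤ g0 K m := by
  have h0 : g0 K m = 10 * m - 8 * K := if_neg (by omega)
  rw [h0]
  have h1 : g1 K c = if c ≤ K then 0 else 10 * c - 5 * K := rfl
  rcases sum_g0 K u Finset.univ with h | ⟨i, -, h, h2, h3⟩ | h
  · rw [h1]; split_ifs <;> omega
  · have := hu i
    rw [h1]; split_ifs <;> omega
  · rw [h1]; split_ifs <;> omega

lemma arith1 {ι : Type} [Fintype ι] (K c c' m : ℕ) (u : ι → ℕ) (hm : K < m)
    (hsum : m = c + (1 + ∑ i, u i) + c') (hc : 2 * c ≤ m) (hc' : 2 * c' ≤ m) :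
    3 * K + g1 K c + g1 K c' + ∑ i, g0 K (u i) ≤ g1 K m := by
  have h0 : g1 K m = 10 * m - 5 * K := if_neg (by omega)
  rw [h0]
  have h1 : g1 K c = if c ≤ K then 0 else 10 * c - 5 * K := rfl
  have h2 : g1 K c' = if c' ≤ K then 0 else 10 * c' - 5 * K := rfl
  rw [h1, h2]
  rcases sum_g0 K u Finset.univ with h | ⟨i, -, h, h2, h3⟩ | h
  · split_ifs <;> omega
  · split_ifs <;> omega
  · split_ifs <;> omega

/-! ### the decomposition -/

def P0 (σ : Type) (ar : σ → ℕ) (K j : ℕ) : Prop :=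
  ∀ t : RTerm σ ar, t.size ≤ 2 ^ j * K → ∃ S : Finset (V σ ar),
    K * S.card ≤ g0 K t.size ∧ Der (Small σ ar K ∪ S) (K + 5 * j) (Sum.inl t)

def P1 (σ : Type) (ar : σ → ℕ) (K j : ℕ) : Prop :=
  ∀ l : List (Step σ ar), l ≠ [] → csize l ≤ 2 ^ j * K → ∃ S : Finset (V σ ar),
    K * S.card ≤ g1 K (csize l) ∧ Der (Small σ ar K ∪ S) (K + 5 * j + 3) (Sum.inr (app l))

lemma small0 (K j : ℕ) (t : RTerm σ ar) (h : t.size ≤ K) : ∃ S : Finset (V σ ar),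
    K * S.card ≤ g0 K t.size ∧ Der (Small σ ar K ∪ S) (K + 5 * j) (Sum.inl t) :=
  ⟨∅, by simp, (small_term K t h).mono Set.subset_union_left _ (by omega)⟩

lemma small1 (K j : ℕ) (l : List (Step σ ar)) (hl : l ≠ []) (h : csize l ≤ K) :
    ∃ S : Finset (V σ ar),
    K * S.card ≤ g1 K (csize l) ∧ Der (Small σ ar K ∪ S) (K + 5 * j + 3) (Sum.inr (app l)) :=
  ⟨∅, by simp, (small_ctx K l hl h).mono Set.subset_union_left _ (by omega)⟩

/-- version of `P1` permitting the empty context -/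
lemma P1.opt {K j : ℕ} (h : P1 σ ar K j) (l : List (Step σ ar)) (hs : csize l ≤ 2 ^ j * K) :
    ∃ S : Finset (V σ ar), K * S.card ≤ g1 K (csize l) ∧
      (l ≠ [] → Der (Small σ ar K ∪ S) (K + 5 * j + 3) (Sum.inr (app l))) := by
  by_cases hl : l = []
  · exact ⟨∅, by simp, fun h => absurd hl h⟩
  · obtain ⟨S, h1, h2⟩ := h l hl hs
    exact ⟨S, h1, fun _ => h2⟩

lemma fam {ι : Type} [Fintype ι] {K j : ℕ} (h : P0 σ ar K j) (u : ι → RTerm σ ar)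
    (hs : ∀ i, (u i).size ≤ 2 ^ j * K) :
    ∃ S : Finset (V σ ar), K * S.card ≤ ∑ i, g0 K (u i).size ∧
      ∀ i, Der (Small σ ar K ∪ S) (K + 5 * j) (Sum.inl (u i)) := by
  classical
  choose S h1 h2 using fun i => h (u i) (hs i)
  refine ⟨Finset.univ.biUnion S, ?_, fun i => ?_⟩
  · calc K * (Finset.univ.biUnion S).card ≤ K * ∑ i, (S i).card :=
          Nat.mul_le_mul_left _ Finset.card_biUnion_le
      _ = ∑ i, K * (S i).card := Finset.mul_sum _ _ _
      _ ≤ _ := Finset.sum_le_sum fun i _ => h1 i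
  · refine (h2 i).mono (Set.union_subset_union_right _ ?_) _ le_rfl
    exact_mod_cast Finset.subset_biUnion_of_mem S (Finset.mem_univ i)

lemma step0 (K j : ℕ) (h0 : P0 σ ar K j) (h1 : P1 σ ar K j) : P0 σ ar K (j + 1) := by
  classical
  intro t ht
  by_cases hK : t.size ≤ K
  · exact small0 K _ t hK
  have hpos := size_pos t
  rw [pow_succ] at ht
  have ht' : t.size ≤ 2 * (2 ^ j * K) := by linarith
  obtain ⟨l, f, args, rfl, e2, e3, e4⟩ := split_term t.size t (by omega)
  set m := (app l (RTerm.node f args)).size with hmdef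
  obtain ⟨A, hA1, hA2⟩ := fam h0 args (fun i => by have := e4 i; omega)
  obtain ⟨B, hB1, hB2⟩ := h1.opt l (by omega)
  have har := arith0 K (csize l) m (fun i => (args i).size) (by omega)
    (by rw [e2, size_node]) (by omega) e4
  let T : Finset (V σ ar) := {Sum.inl (RTerm.node f args), Sum.inl (app l (RTerm.node f args))}
  have hT : T.card ≤ 2 := Finset.card_le_two
  refine ⟨T ∪ (A ∪ B), ?_, ?_⟩
  · have hc : (T ∪ (A ∪ B)).card ≤ 2 + (A.card + B.card) :=
      (Finset.card_union_le _ _).trans (add_le_add hT (Finset.card_union_le _ _))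
    have := Nat.mul_le_mul_left K hc
    have e : K * (2 + (A.card + B.card)) = 2 * K + K * A.card + K * B.card := by ring
    omega
  · have hnode : Der (Small σ ar K ∪ ↑(T ∪ (A ∪ B))) (K + 5 * j + 1)
        (Sum.inl (RTerm.node f args)) := by
      refine .base0 _ f args (Or.inr (by simp [T])) fun i => ?_
      refine (hA2 i).mono (Set.union_subset_union_right _ ?_) _ le_rfl
      intro x hx; simp at hx ⊢; tauto
    by_cases hl : l = []
    · subst hl
      exact hnode.mono subset_rfl _ (by omega)
    · have hctx := hB2 hl
      have := Der.sub (S := Small σ ar K ∪ ↑(T ∪ (A ∪ B))) (K + 5 * j + 3) (app l)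
        (RTerm.node f args) (Or.inr (by simp [T])) ?_ (hnode.mono subset_rfl _ (by omega))
      · exact this.mono subset_rfl _ (by omega)
      · refine hctx.mono (Set.union_subset_union_right _ ?_) _ le_rfl
        intro x hx; simp at hx ⊢; tauto

lemma step1 (K j : ℕ) (h0 : P0 σ ar K (j + 1)) (h1 : P1 σ ar K j) : P1 σ ar K (j + 1) := by
  classical
  intro l hl ht
  by_cases hK : csize l ≤ K
  · exact small1 K _ l hl hK
  have ht2 := ht
  rw [pow_succ] at ht
  have ht' : csize l ≤ 2 * (2 ^ j * K) := by linarith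
  obtain ⟨s1, st, s2, rfl, e1, e2⟩ := split_list l (csize l / 2) (by omega)
  set m := csize (s1 ++ st :: s2) with hmdef
  have hm : m = csize s1 + st.size + csize s2 := by
    rw [hmdef, csize_append, csize]; omega
  have hst : st.size = 1 + ∑ j, (st.args j).size := rfl
  have key : ∀ i, (st.args i).size ≤ ∑ i, (st.args i).size := fun i =>
      Finset.single_le_sum (f := fun i => (st.args i).size) (fun _ _ => Nat.zero_le _)
        (Finset.mem_univ i)
  obtain ⟨A, hA1, hA2⟩ := fam h0 st.args (fun i => by have := key i; omega)
  obtain ⟨B, hB1, hB2⟩ := h1.opt s1 (by omega)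
  obtain ⟨D, hD1, hD2⟩ := h1.opt s2 (by omega)
  have har := arith1 K (csize s1) (csize s2) m (fun i => (st.args i).size) (by omega)
    (by rw [hm, hst]) (by omega) (by omega)
  let T : Finset (V σ ar) := {Sum.inr st.app, Sum.inr (app (st :: s2)),
    Sum.inr (app (s1 ++ st :: s2))}
  have hT : T.card ≤ 3 := Finset.card_le_three
  refine ⟨T ∪ (A ∪ (B ∪ D)), ?_, ?_⟩
  · have hc : (T ∪ (A ∪ (B ∪ D))).card ≤ 3 + (A.card + (B.card + D.card)) :=
      (Finset.card_union_le _ _).trans (add_le_add hT ((Finset.card_union_le _ _).trans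
        (add_le_add le_rfl (Finset.card_union_le _ _))))
    have := Nat.mul_le_mul_left K hc
    have e : K * (3 + (A.card + (B.card + D.card))) =
      3 * K + K * A.card + K * B.card + K * D.card := by ring
    omega
  · set U : Set (V σ ar) := Small σ ar K ∪ ↑(T ∪ (A ∪ (B ∪ D))) with hU
    have a1 : Der U (K + 5 * (j + 1) + 1) (Sum.inr st.app) := by
      refine .base1 _ st.f st.i st.args (Or.inr ?_) fun i => ?_
      · show Sum.inr st.app ∈ _
        simp [T]
      · refine (hA2 i).mono (Set.union_subset_union_right _ ?_) _ le_rfl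
        intro x hx; simp at hx ⊢; tauto
    have a2 : Der U (K + 5 * (j + 1) + 2) (Sum.inr (app (st :: s2))) := by
      by_cases h2 : s2 = []
      · subst h2
        exact a1.mono subset_rfl _ (by omega)
      · refine .comp _ st.app (app s2) (Or.inr ?_) a1 ?_
        · show Sum.inr (app (st :: s2)) ∈ _
          simp [T]
        · refine (hD2 h2).mono (Set.union_subset_union_right _ ?_) _ (by omega)
          intro x hx; simp at hx ⊢; tauto
    by_cases h2 : s1 = []
    · subst h2
      exact a2.mono subset_rfl _ (by omega)
    · have hmem : Sum.inr (app (s1 ++ st :: s2)) ∈ U := Or.inr (by simp [T])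
      rw [app_append] at hmem ⊢
      refine .comp _ (app s1) (app (st :: s2)) hmem ?_ a2
      refine (hB2 h2).mono (Set.union_subset_union_right _ ?_) _ (by omega)
      intro x hx; simp at hx ⊢; tauto

lemma main_dec (K j : ℕ) : P0 σ ar K j ∧ P1 σ ar K j := by
  induction j with
  | zero =>
    exact ⟨fun t ht => small0 K 0 t (by simpa using ht),
      fun l hl h => small1 K 0 l hl (by simpa using h)⟩
  | succ j ih =>
    have h := step0 K j ih.1 ih.2
    exact ⟨h, step1 K j h ih.2⟩

/-! ### the grammar -/

lemma grammar (U : Set (V σ ar)) (hU : U.Finite) (D : ℕ) (t : RTerm σ ar)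
    (ht : Der U D (Sum.inl t)) :
    ∃ (N : Type) (_ : Fintype N) (rank : N → Bool) (S : N)
          (rhs : N → Rhs σ ar N) (val0 : N → RTerm σ ar)
          (val1 : N → RTerm σ ar → RTerm σ ar) (dp : N → ℕ),
          rank S = false ∧
          (∀ A, RankOk rank A (rhs A)) ∧
          (∀ A B, (rhs A).Occurs B → dp B < dp A) ∧
          (∀ A, dp A ≤ D) ∧
          (∀ A, ValOk val0 val1 A (rhs A)) ∧
          Fintype.card N ≤ U.ncard ∧
          val0 S = t := by
  classical
  let N : Type := {v : V σ ar // Der U D v}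
  have hsub : {v : V σ ar | Der U D v} ⊆ U := fun v hv => hv.mem
  have hfin : Finite N := (hU.subset hsub).to_subtype
  let fN : Fintype N := Fintype.ofFinite N
  have hex : ∀ v : N, ∃ d, Der U d v.1 := fun v => ⟨D, v.2⟩
  let dp : N → ℕ := fun v => Nat.find (hex v)
  have hdp : ∀ v : N, Der U (dp v) v.1 := fun v => Nat.find_spec (hex v)
  have hle : ∀ (v : N) d, Der U d v.1 → dp v ≤ d := fun v d h => Nat.find_min' (hex v) h
  let rank : N → Bool := fun v => v.1.isRight
  let val0 : N → RTerm σ ar := fun v => Sum.elim id (fun _ => t) v.1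
  let val1 : N → RTerm σ ar → RTerm σ ar := fun v => Sum.elim (fun _ => id) id v.1
  have key : ∀ A : N, ∃ r : Rhs σ ar N, RankOk rank A r ∧ (∀ B, r.Occurs B → dp B < dp A) ∧
      ValOk val0 val1 A r := by
    rintro A
    have hA := hdp A
    have hD : dp A ≤ D := hle A D A.2
    generalize dp A = e at hA hD
    obtain ⟨v, hv⟩ := A
    simp only at hA
    cases hA with
    | base0 d f args hm h =>
      refine ⟨.base0 f fun i => ⟨Sum.inl (args i), (h i).mono subset_rfl _ (by omega)⟩,
        ⟨rfl, fun i => rfl⟩, ?_, rfl⟩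
      rintro B ⟨i, rfl⟩
      exact Nat.lt_succ_of_le (hle _ _ (h i))
    | base1 d f i args hm h =>
      refine ⟨.base1 f i fun i => ⟨Sum.inl (args i), (h i).mono subset_rfl _ (by omega)⟩,
        ⟨rfl, fun i => rfl⟩, ?_, rfl⟩
      rintro B ⟨i, rfl⟩
      exact Nat.lt_succ_of_le (hle _ _ (h i))
    | sub d B t hm hB ht =>
      refine ⟨.sub ⟨Sum.inr B, hB.mono subset_rfl _ (by omega)⟩
        ⟨Sum.inl t, ht.mono subset_rfl _ (by omega)⟩, ⟨rfl, rfl, rfl⟩, ?_, rfl⟩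
      rintro X (rfl | rfl)
      · exact Nat.lt_succ_of_le (hle _ _ hB)
      · exact Nat.lt_succ_of_le (hle _ _ ht)
    | comp d B B' hm hB ht =>
      refine ⟨.comp ⟨Sum.inr B, hB.mono subset_rfl _ (by omega)⟩
        ⟨Sum.inr B', ht.mono subset_rfl _ (by omega)⟩, ⟨rfl, rfl, rfl⟩, ?_, rfl⟩
      rintro X (rfl | rfl)
      · exact Nat.lt_succ_of_le (hle _ _ hB)
      · exact Nat.lt_succ_of_le (hle _ _ ht)
  choose rhs h1 h2 h3 using key
  refine ⟨N, fN, rank, ⟨Sum.inl t, ht⟩, rhs, val0, val1, dp, rfl, h1, h2,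
    fun A => hle A D A.2, h3, ?_, rfl⟩
  have : Fintype.card N = {v : V σ ar | Der U D v}.ncard := by
    rw [← Nat.card_eq_fintype_card]; rfl
  rw [this]
  exact Set.ncard_le_ncard hsub hU

end Bal

/-- **Universal balancing theorem (combinatorial form of Theorem 5.2)**: for
every ranked alphabet `Σ` there is a constant `C` such that for every term
`t ∈ T(Σ)` of size `n ≥ 2` there exists a tree straight-line program `G` over
`Σ` in normal form with `val(G) = t`, of size (number of nonterminals) at most
`C·n/log₂ n` and of depth (length of a longest chain in the acyclic dependency
relation, witnessed by the ranking function `dp`) at most `C·log₂ n`. -/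
theorem stmt0 (σ : Type) (ar : σ → ℕ) [Fintype σ] :
    ∃ C : ℝ, 0 < C ∧
      ∀ (t : RTerm σ ar) (n : ℕ), n = t.size → 2 ≤ n →
        ∃ (N : Type) (_ : Fintype N) (rank : N → Bool) (S : N)
          (rhs : N → Rhs σ ar N) (val0 : N → RTerm σ ar)
          (val1 : N → RTerm σ ar → RTerm σ ar) (dp : N → ℕ),
          -- the start nonterminal has rank 0
          rank S = false ∧
          -- the productions are rank-correct (hence in normal form)
          (∀ A, RankOk rank A (rhs A)) ∧
          -- the dependency relation is acyclic, of depth at most `C·log₂ n`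
          (∀ A B, (rhs A).Occurs B → dp B < dp A) ∧
          (∀ A, (dp A : ℝ) ≤ C * Real.logb 2 n) ∧
          -- the values of the nonterminals are consistent with the productions
          (∀ A, ValOk val0 val1 A (rhs A)) ∧
          -- the size of the TSLP is at most `C·n/log₂ n`
          (Fintype.card N : ℝ) ≤ C * n / Real.logb 2 n ∧
          -- the TSLP derives `t`
          val0 S = t := by
  classical
  set Q : ℕ := Fintype.card (Bal.Tok σ ar) + 2 with hQ
  have hQ2 : 2 ≤ Q := by omega
  have hQ2r : (2 : ℝ) ≤ Q := by exact_mod_cast hQ2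
  have hlQ : 1 ≤ Real.logb 2 Q := by
    rw [Real.le_logb_iff_rpow_le (by norm_num) (by positivity)]; simpa using hQ2r
  refine ⟨4 * Q + 20 * Real.logb 2 Q + 12, by positivity, ?_⟩
  intro t n hn h2
  set k := Nat.log Q n / 2 with hk
  set K := k + 1 with hKdef
  have hn0 : n ≠ 0 := by omega
  have hnr : (2 : ℝ) ≤ n := by exact_mod_cast h2
  set L := Real.logb 2 n with hL
  have hL1 : 1 ≤ L := by
    rw [hL, Real.le_logb_iff_rpow_le (by norm_num) (by positivity)]; simpa using hnr
  -- the power bound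
  have hpow : (Q ^ k) ^ 2 ≤ n := by
    rw [← pow_mul]
    exact (Nat.pow_le_pow_right (by omega) (by omega)).trans (Nat.pow_log_le_self Q hn0)
  -- `K` is large
  have hKlow : L ≤ 2 * K * Real.logb 2 Q := by
    have h : n < Q ^ (2 * K) :=
      (Nat.lt_pow_succ_log_self (by omega) n).trans_le (Nat.pow_le_pow_right (by omega) (by omega))
    have h' : (n : ℝ) ≤ (Q : ℝ) ^ (2 * K) := by exact_mod_cast h.le
    have h3 := Real.logb_le_logb_of_le (b := 2) (by norm_num) (by positivity) h'
    rw [Real.logb_pow] at h3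
    push_cast at h3 ⊢
    exact h3
  -- `K` is small
  have hKup : 2 * (k : ℝ) ≤ L := by
    have h : 2 ^ (2 * k) ≤ n := by
      rw [mul_comm, pow_mul]
      exact (Nat.pow_le_pow_left (Nat.pow_le_pow_left hQ2 k) 2).trans hpow
    have h' : (2 : ℝ) ^ (2 * k) ≤ n := by exact_mod_cast h
    have h3 := Real.logb_le_logb_of_le (b := 2) (by norm_num) (by positivity) h'
    rw [Real.logb_pow, Real.logb_self_eq_one (by norm_num)] at h3
    push_cast at h3
    linarith
  set j := Nat.log 2 n + 1 with hj
  have hjn : n ≤ 2 ^ j * K := by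
    have h := (Nat.lt_pow_succ_log_self (b := 2) (by omega) n).le
    calc n ≤ 2 ^ j * 1 := by simpa using h
      _ ≤ _ := Nat.mul_le_mul_left _ (by omega)
  have hjL : (j : ℝ) ≤ L + 1 := by
    have h' : (2 : ℝ) ^ (Nat.log 2 n) ≤ n := by exact_mod_cast Nat.pow_log_le_self 2 hn0
    have h3 := Real.logb_le_logb_of_le (b := 2) (by norm_num) (by positivity) h'
    rw [Real.logb_pow, Real.logb_self_eq_one (by norm_num)] at h3
    push_cast [hj]
    linarith
  -- `log n ≤ 2 √n`
  have hsq : L ≤ 2 * Real.sqrt n := by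
    have hs : 0 < Real.sqrt n := Real.sqrt_pos.2 (by linarith)
    have e : L = 2 * Real.logb 2 (Real.sqrt n) := by
      rw [hL]
      conv_lhs => rw [← Real.sq_sqrt (show (0 : ℝ) ≤ n by linarith)]
      rw [Real.logb_pow]; norm_num
    rw [e]
    have : Real.logb 2 (Real.sqrt n) ≤ Real.sqrt n := by
      rw [Real.logb_le_iff_le_rpow (by norm_num) hs]
      have hb := one_add_mul_self_le_rpow_one_add (s := 1) (by norm_num) (p := max 1 (Real.sqrt n)) (le_max_left _ _)
      have h1s : 1 ≤ Real.sqrt n := Real.one_le_sqrt.2 (by linarith)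
      rw [max_eq_right h1s] at hb
      norm_num at hb
      linarith
    linarith
  obtain ⟨S, hS1, hS2⟩ := (Bal.main_dec (σ := σ) (ar := ar) K j).1 t (hn ▸ hjn)
  have hsm := Bal.small_card (σ := σ) (ar := ar) K
  obtain ⟨N, fN, rank, S0, rhs, val0, val1, dp, c1, c2, c3, c4, c5, c6, c7⟩ :=
    Bal.grammar _ (hsm.1.union S.finite_toSet) _ t hS2
  refine ⟨N, fN, rank, S0, rhs, val0, val1, dp, c1, c2, c3, ?_, c5, ?_, c7⟩
  · intro A
    have h : (dp A : ℝ) ≤ K + 5 * j := by exact_mod_cast c4 A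
    have hKr : (K : ℝ) = k + 1 := by push_cast [hKdef]; ring
    have hx : (dp A : ℝ) ≤ 12 * L := by linarith
    refine hx.trans ?_
    apply mul_le_mul_of_nonneg_right _ (by linarith)
    nlinarith
  · have hcard : Fintype.card N ≤ 2 * Q ^ K + S.card := by
      refine c6.trans ((Set.ncard_union_le _ _).trans ?_)
      rw [Set.ncard_coe_finset]
      have h5 : (Fintype.card (Bal.Tok σ ar) + 1) ^ K ≤ Q ^ K := Nat.pow_le_pow_left (by omega) K
      have := hsm.2
      omega
    have hSc : K * S.card ≤ 10 * n := by
      refine hS1.trans ?_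
      rw [← hn]; unfold Bal.g0; split_ifs <;> omega
    have hScr : (K : ℝ) * S.card ≤ 10 * n := by exact_mod_cast hSc
    have hcr : (Fintype.card N : ℝ) ≤ 2 * (Q : ℝ) ^ K + S.card := by exact_mod_cast hcard
    have hQk : (Q : ℝ) ^ k ≤ Real.sqrt n := by
      apply Real.le_sqrt_of_sq_le
      exact_mod_cast hpow
    have hb1 : (Q : ℝ) ^ K * L ≤ 2 * Q * n := by
      have hs0 := Real.sqrt_nonneg (n : ℝ)
      calc (Q : ℝ) ^ K * L = Q * ((Q : ℝ) ^ k * L) := by rw [hKdef, pow_succ]; ring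
        _ ≤ Q * (Real.sqrt n * (2 * Real.sqrt n)) := by gcongr
        _ = 2 * Q * (Real.sqrt n * Real.sqrt n) := by ring
        _ = 2 * Q * n := by rw [Real.mul_self_sqrt (by linarith)]
    have hb2 : (S.card : ℝ) * L ≤ 20 * Real.logb 2 Q * n := by
      calc (S.card : ℝ) * L ≤ S.card * (2 * K * Real.logb 2 Q) := by gcongr
        _ = 2 * Real.logb 2 Q * (K * S.card) := by ring
        _ ≤ 2 * Real.logb 2 Q * (10 * n) := by gcongr
        _ = _ := by ring
    rw [le_div_iff₀ (by linarith)]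
    have := mul_le_mul_of_nonneg_right hcr (show (0 : ℝ) ≤ L by linarith)
    nlinarith
end

section
/- Combinatorial form of Theorem 5.5: For every ranked alphabet Σ there is a constant C (depending only on Σ) such that for every algebra A over Σ and every term t ∈ T(Σ) of size n ≥ 2 there exists a term s over the two-sorted algebra F(A), of sort A, whose depth is at most C·log₂ n and whose value in F(A) equals the value t^A of t in A. -/
/-- The value of a term in an algebra with operations `interp`. -/
def RTerm.eval {σ : Type} {ar : σ → ℕ} {A : Type}
    (interp : ∀ f : σ, (Fin (ar f) → A) → A) : RTerm σ ar → A
  | .node f args => interp f fun i => (args i).eval interp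

/-- Terms over the two-sorted algebra `F(A)`, indexed by their sort:
`false` is the sort `A` and `true` is the sort `A[x]` of linear term functions.
Constructors: the operations `f^A : A^r → A` for `f ∈ Σ`, the operations
`f̂ᵢ : A^{r-1} → A[x]`, substitution `sub : A[x] × A → A` and composition
`∘ : A[x] × A[x] → A[x]`. -/
inductive FTerm (σ : Type) (ar : σ → ℕ) : Bool → Type
  | app (f : σ) (args : Fin (ar f) → FTerm σ ar false) : FTerm σ ar false
  | hat (f : σ) (i : Fin (ar f)) (args : Fin (ar f - 1) → FTerm σ ar false) :
      FTerm σ ar true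
  | sub (p : FTerm σ ar true) (a : FTerm σ ar false) : FTerm σ ar false
  | comp (p q : FTerm σ ar true) : FTerm σ ar true

/-- The carrier of the sort `b` of `F(A)`. -/
def sortTy (A : Type) : Bool → Type
  | false => A
  | true => A → A

/-- The value of an `F(A)`-term.  A term of sort `A[x]` evaluates to a linear
term function `A → A` (these are exactly the functions generated by the
operations `f̂ᵢ` and composition). -/
def FTerm.eval {σ : Type} {ar : σ → ℕ} {A : Type}
    (interp : ∀ f : σ, (Fin (ar f) → A) → A) :
    ∀ {b : Bool}, FTerm σ ar b → sortTy A b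
  | _, .app f args => interp f fun i => (args i).eval interp
  | _, .hat f i args => fun x => interp f (plugAt i (fun j => (args j).eval interp) x)
  | _, .sub p a => (p.eval interp) (a.eval interp)
  | _, .comp p q => fun x => (p.eval interp) ((q.eval interp) x)

/-- The depth (height) of an `F(A)`-term. -/
def FTerm.depth {σ : Type} {ar : σ → ℕ} :
    ∀ {b : Bool}, FTerm σ ar b → ℕ
  | _, .app _ args => 1 + Finset.univ.sup fun i => (args i).depth
  | _, .hat _ _ args => 1 + Finset.univ.sup fun i => (args i).depth
  | _, .sub p a => 1 + max p.depth a.depth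
  | _, .comp p q => 1 + max p.depth q.depth

/-- Application of an `A[x]`-term. -/
def FTerm.fn {σ : Type} {ar : σ → ℕ} {A : Type}
    (interp : ∀ f : σ, (Fin (ar f) → A) → A) (p : FTerm σ ar true) (x : A) : A :=
  (FTerm.eval interp p : A → A) x

/-- Value of a `A`-sorted term. -/
def FTerm.vl {σ : Type} {ar : σ → ℕ} {A : Type}
    (interp : ∀ f : σ, (Fin (ar f) → A) → A) (p : FTerm σ ar false) : A :=
  (FTerm.eval interp p : A)

theorem split_list {α : Type} (w : α → ℝ) (L : List α) :
    ∀ H : ℝ, 0 ≤ H → H ≤ (L.map w).sum → L ≠ [] →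
      ∃ l1 p l2, L = l1 ++ p :: l2 ∧ (l1.map w).sum ≤ H ∧
        (l2.map w).sum ≤ (L.map w).sum - H := by
  induction L with
  | nil => intro H _ _ h; exact absurd rfl h
  | cons p L ih =>
    intro H h0 h1 _
    simp only [List.map_cons, List.sum_cons] at h1
    by_cases hp : H ≤ w p
    · exact ⟨[], p, L, rfl, by simpa using h0, by simp; linarith⟩
    · push Not at hp
      have hne : L ≠ [] := by
        rintro rfl
        simp at h1; linarith
      obtain ⟨l1, q, l2, e, a, b⟩ := ih (H - w p) (by linarith) (by linarith) hne
      refine ⟨p :: l1, q, l2, by simp [e], by simp; linarith, ?_⟩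
      simp only [List.map_cons, List.sum_cons]; linarith

theorem pow_max_le {r B : ℝ} {a b : ℕ} (ha : r * r ^ a ≤ B) (hb : r * r ^ b ≤ B) :
    r ^ (1 + max a b) ≤ B := by
  rw [pow_add, pow_one]
  rcases max_choice a b with h | h <;> rw [h] <;> assumption

theorem kraft {σ : Type} {ar : σ → ℕ} {A : Type}
    (interp : ∀ f : σ, (Fin (ar f) → A) → A) (r : ℝ) (hr : 1 ≤ r) (hr2 : r * r = 2) (n : ℕ) :
    ∀ L : List (FTerm σ ar true), L.length = n → L ≠ [] →
      ∃ q : FTerm σ ar true, r ^ q.depth ≤ 2 * (L.map fun p => r ^ p.depth).sum ∧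
        ∀ x : A, q.fn interp x = L.foldr (fun p a => p.fn interp a) x := by
  induction n using Nat.strong_induction_on with
  | _ n ih =>
  intro L hn hL
  have hnn : ∀ l : List (FTerm σ ar true), 0 ≤ (l.map fun p => r ^ p.depth).sum := by
    intro l
    apply List.sum_nonneg
    simp only [List.mem_map]
    rintro _ ⟨p, _, rfl⟩
    positivity
  have hS := hnn L
  obtain ⟨l1, p, l2, e, h1, h2⟩ := split_list (fun p : FTerm σ ar true => r ^ p.depth) L
    ((L.map fun p => r ^ p.depth).sum / 2) (by linarith) (by linarith) hL
  have hp : r ^ p.depth ≤ (L.map fun p => r ^ p.depth).sum := by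
    have := hnn l1
    have := hnn l2
    rw [e]; simp; linarith
  have hr' : r ≤ 2 := by nlinarith
  generalize (L.map fun p => r ^ p.depth).sum = S at *
  subst e
  simp only [List.length_append, List.length_cons] at hn
  have st1 : ∃ q : FTerm σ ar true, r ^ q.depth ≤ r * S ∧
        ∀ x : A, q.fn interp x = (p :: l2).foldr (fun p a => p.fn interp a) x := by
    by_cases hl : l2 = []
    · subst hl
      exact ⟨p, by nlinarith, fun x => rfl⟩
    · obtain ⟨q, a, b⟩ := ih l2.length (by omega) l2 rfl hl
      refine ⟨.comp p q, ?_, fun x => ?_⟩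
      · simp only [FTerm.depth]
        apply pow_max_le
        · gcongr
        · gcongr; linarith
      · simp only [List.foldr_cons, ← b]; rfl
  obtain ⟨q', a', b'⟩ := st1
  by_cases hl : l1 = []
  · subst hl
    exact ⟨q', by nlinarith, b'⟩
  · obtain ⟨q, a, b⟩ := ih l1.length (by omega) l1 rfl hl
    refine ⟨.comp q q', ?_, fun x => ?_⟩
    · simp only [FTerm.depth]
      apply pow_max_le
      · nlinarith
      · nlinarith
    · rw [List.foldr_append, ← b', ← b]; rfl

theorem size_pos' {σ : Type} {ar : σ → ℕ} (t : RTerm σ ar) : 1 ≤ t.size := by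
  cases t; simp [RTerm.size]

/-- The index in `Fin r` of the `k`-th argument other than `i`. -/
def skipIdx {r : ℕ} (i : Fin r) (k : Fin (r - 1)) : Fin r :=
  if (k : ℕ) < (i : ℕ) then ⟨k, by omega⟩ else ⟨k + 1, by omega⟩

theorem skipIdx_ne {r : ℕ} (i : Fin r) (k : Fin (r - 1)) : skipIdx i k ≠ i := by
  unfold skipIdx
  intro h
  have := congrArg Fin.val h
  split_ifs at this <;> simp at this <;> omega

theorem plugAt_skip {A : Type} {r : ℕ} (i : Fin r) (v : Fin r → A) :
    plugAt i (fun k => v (skipIdx i k)) (v i) = v := by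
  funext j
  unfold plugAt
  split_ifs with h1 h2
  · simp [skipIdx, h1]
  · congr 1; exact (Fin.ext h2).symm
  · have h3 : ¬ ((j : ℕ) - 1 < (i : ℕ)) := by omega
    simp only [skipIdx, h3, if_false]
    congr 1; apply Fin.ext; simp; omega

theorem path_lemma {σ : Type} {ar : σ → ℕ} {A : Type}
    (interp : ∀ f : σ, (Fin (ar f) → A) → A) (r : ℝ) (hr : 1 ≤ r) (M : ℕ)
    (ih : ∀ s : RTerm σ ar, 2 * s.size ≤ M → ∃ u : FTerm σ ar false,
      r ^ u.depth ≤ 2 * (s.size : ℝ) ^ 3 ∧ u.vl interp = s.eval interp) (t : RTerm σ ar) :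
    t.size ≤ M → ∃ (L : List (FTerm σ ar true)) (u : FTerm σ ar false), u.depth = 1 ∧
      t.eval interp = L.foldr (fun p a => p.fn interp a) (u.vl interp) ∧
      (L.map fun p => r ^ p.depth).sum ≤ r * 2 * ((M : ℝ) / 2) ^ 2 * t.size := by
  induction t with
  | node f args iht =>
  intro hM
  rcases Nat.eq_zero_or_pos (ar f) with h0 | hpos
  · have : IsEmpty (Fin (ar f)) := by rw [h0]; infer_instance
    refine ⟨[], .app f (fun i => isEmptyElim i), ?_, ?_, ?_⟩
    · simp [FTerm.depth]
    · simp only [RTerm.eval, List.foldr_nil, FTerm.vl, FTerm.eval]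
      congr 1; funext i; exact isEmptyElim i
    · simp; positivity
  · have : Nonempty (Fin (ar f)) := ⟨⟨0, hpos⟩⟩
    obtain ⟨i, hi⟩ := Finite.exists_max (fun i => (args i).size)
    have hsize : (RTerm.node f args).size =
        1 + ((args i).size + ∑ j ∈ Finset.univ.erase i, (args j).size) := by
      rw [RTerm.size, Finset.add_sum_erase _ (fun j => (args j).size) (Finset.mem_univ i)]
    have hle : ∀ j, j ≠ i → (args j).size ≤ ∑ j ∈ Finset.univ.erase i, (args j).size := by
      intro j hj
      exact Finset.single_le_sum (f := fun j => (args j).size) (fun _ _ => Nat.zero_le _)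
        (Finset.mem_erase.2 ⟨hj, Finset.mem_univ j⟩)
    generalize hT : ∑ j ∈ Finset.univ.erase i, (args j).size = T at *
    have hlight : ∀ j, j ≠ i → 2 * (args j).size ≤ M := by
      intro j hj
      have h1 := hi j
      have h2 := hle j hj
      omega
    obtain ⟨L, u, hu, he, hs⟩ := iht i (by omega)
    have hside : ∀ k : Fin (ar f - 1), ∃ u : FTerm σ ar false,
        r ^ u.depth ≤ 2 * ((args (skipIdx i k)).size : ℝ) ^ 3 ∧
        u.vl interp = (args (skipIdx i k)).eval interp :=
      fun k => ih _ (hlight _ (skipIdx_ne i k))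
    choose v hv hv' using hside
    refine ⟨.hat f i v :: L, u, hu, ?_, ?_⟩
    · simp only [List.foldr_cons, ← he]
      have : (fun k => (v k).vl interp) = fun k => (args (skipIdx i k)).eval interp :=
        funext hv'
      show _ = interp f (plugAt i (fun k => (v k).vl interp) _)
      rw [this, plugAt_skip i (fun j => (args j).eval interp), RTerm.eval]
    · have hM2 : (2 : ℝ) ≤ M := by
        have := size_pos' (args i)
        exact_mod_cast (by omega : 2 ≤ M)
      have hsz : (((RTerm.node f args).size : ℕ) : ℝ) = (args i).size + (1 + T) := by
        rw [hsize]; push_cast; ring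
      simp only [List.map_cons, List.sum_cons]
      rw [hsz, mul_add, add_comm]
      refine add_le_add hs ?_
      simp only [FTerm.depth]
      rw [pow_add, pow_one, mul_assoc, mul_assoc]
      refine mul_le_mul_of_nonneg_left ?_ (by linarith)
      have hT0 : (0 : ℝ) ≤ T := Nat.cast_nonneg _
      rcases isEmpty_or_nonempty (Fin (ar f - 1)) with hE | hE
      · rw [Finset.univ_eq_empty]
        simp only [Finset.sup_empty, bot_eq_zero, pow_zero]
        nlinarith [mul_nonneg (sq_nonneg ((M : ℝ) / 2)) hT0]
      · obtain ⟨k, -, hk⟩ := Finset.exists_mem_eq_sup Finset.univ Finset.univ_nonempty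
          (fun k => (v k).depth)
        rw [hk]
        refine (hv k).trans ?_
        have h1 : (((args (skipIdx i k)).size : ℕ) : ℝ) ≤ M / 2 := by
          have : (2 : ℝ) * (args (skipIdx i k)).size ≤ M := by
            exact_mod_cast hlight _ (skipIdx_ne i k)
          linarith
        have h2 : (((args (skipIdx i k)).size : ℕ) : ℝ) ≤ 1 + T := by
          have : (((args (skipIdx i k)).size : ℕ) : ℝ) ≤ T := by
            exact_mod_cast hle _ (skipIdx_ne i k)
          linarith
        rw [pow_succ]
        gcongr

theorem main_bound {σ : Type} {ar : σ → ℕ} {A : Type}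
    (interp : ∀ f : σ, (Fin (ar f) → A) → A) (r : ℝ) (hr : 1 ≤ r) (hr2 : r * r = 2) (n : ℕ) :
    ∀ t : RTerm σ ar, t.size = n → ∃ u : FTerm σ ar false,
      r ^ u.depth ≤ 2 * (t.size : ℝ) ^ 3 ∧ u.vl interp = t.eval interp := by
  induction n using Nat.strong_induction_on with
  | _ n ih =>
  intro t ht
  have hpos := size_pos' t
  have h1 : (1 : ℝ) ≤ t.size := by exact_mod_cast hpos
  have h3 : (1 : ℝ) ≤ (t.size : ℝ) ^ 3 := one_le_pow₀ h1
  have hr' : r ≤ 2 := by nlinarith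
  obtain ⟨L, u, hu, he, hs⟩ := path_lemma interp r hr t.size
    (fun s hs => ih s.size (by omega) s rfl) t le_rfl
  by_cases hL : L = []
  · subst hL
    refine ⟨u, ?_, he.symm⟩
    rw [hu, pow_one]; linarith
  · obtain ⟨q, hq, hq'⟩ := kraft interp r hr hr2 L.length L rfl hL
    refine ⟨.sub q u, ?_, ?_⟩
    · simp only [FTerm.depth]
      apply pow_max_le
      · calc r * r ^ q.depth ≤ r * (2 * (r * 2 * ((t.size : ℝ) / 2) ^ 2 * t.size)) := by
              gcongr; linarith
          _ = (r * r) * (t.size : ℝ) ^ 3 := by ring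
          _ ≤ _ := by rw [hr2]
      · rw [hu, pow_one, hr2]; linarith
    · rw [he, ← hq']; rfl

/-- **Combinatorial form of Theorem 5.5**: for every ranked alphabet `Σ` there is
a constant `C` such that for every algebra `A` over `Σ` and every term `t` over
`Σ` of size `n ≥ 2` there exists a term `s` over the two-sorted algebra `F(A)`,
of sort `A`, whose depth is at most `C·log₂ n` and whose value in `F(A)` equals
the value `t^A` of `t` in `A`. -/
theorem stmt1 (σ : Type) (ar : σ → ℕ) [Fintype σ] :
    ∃ C : ℝ, 0 < C ∧
      ∀ (A : Type) (_ : Nonempty A) (interp : ∀ f : σ, (Fin (ar f) → A) → A)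
        (t : RTerm σ ar) (n : ℕ), n = t.size → 2 ≤ n →
        ∃ s : FTerm σ ar false,
          (s.depth : ℝ) ≤ C * Real.logb 2 n ∧ s.eval interp = t.eval interp := by
  refine ⟨8, by norm_num, ?_⟩
  intro A _ interp t n hn h2
  have hs2 : Real.sqrt 2 * Real.sqrt 2 = 2 := Real.mul_self_sqrt (by norm_num)
  have hs1 : 1 ≤ Real.sqrt 2 := Real.one_le_sqrt.2 (by norm_num)
  obtain ⟨u, hu, he⟩ := main_bound interp (Real.sqrt 2) hs1 hs2 _ t rfl
  refine ⟨u, ?_, he⟩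
  rw [← hn] at hu
  have hn2 : (2 : ℝ) ≤ n := by exact_mod_cast h2
  have hlog : 1 ≤ Real.logb 2 n := by
    rw [Real.le_logb_iff_rpow_le (by norm_num) (by linarith)]
    simpa using hn2
  have hsq : (2 : ℝ) ^ u.depth ≤ (2 * (n : ℝ) ^ 3) ^ 2 := by
    calc (2 : ℝ) ^ u.depth = (Real.sqrt 2 ^ u.depth) ^ 2 := by
          rw [← pow_mul, mul_comm, pow_mul, pow_two, hs2]
      _ ≤ _ := by gcongr
  have hfin : (2 : ℝ) ^ u.depth ≤ (n : ℝ) ^ 8 := by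
    calc (2 : ℝ) ^ u.depth ≤ 2 ^ 2 * (n : ℝ) ^ 6 := by
          refine hsq.trans (le_of_eq (by ring))
      _ ≤ (n : ℝ) ^ 2 * (n : ℝ) ^ 6 := by gcongr
      _ = _ := by ring
  have := Real.logb_le_logb_of_le (b := 2) (by norm_num) (by positivity) hfin
  rw [Real.logb_pow, Real.logb_pow, Real.logb_self_eq_one (by norm_num)] at this
  push_cast at this
  linarith
end

section
/- Let T be a full binary tree with n nodes and let 1 < m ≤ n. Then the number of m-critical nodes of T is at most 2n/m − 1. -/
/-- Full binary trees: every node has either no children or exactly two. -/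
inductive FBT : Type
  | leaf : FBT
  | node : FBT → FBT → FBT

/-- The number of nodes of a full binary tree. -/
def FBT.size : FBT → ℕ
  | .leaf => 1
  | .node l r => 1 + l.size + r.size

/-- Ceiling division of natural numbers, `⌈a/m⌉`. -/
def cdiv (a m : ℕ) : ℕ := (a + m - 1) / m

/-- An inner node `v` is `m`-critical if `⌈|T[v]|/m⌉ ≠ ⌈|T[w]|/m⌉` for every
child `w` of `v`.  `critCount m t` counts the `m`-critical nodes of `t`. -/
def FBT.critCount (m : ℕ) : FBT → ℕ
  | .leaf => 0
  | .node l r =>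
      (if cdiv (FBT.node l r).size m ≠ cdiv l.size m ∧
          cdiv (FBT.node l r).size m ≠ cdiv r.size m then 1 else 0)
        + l.critCount m + r.critCount m

theorem FBT.size_pos (T : FBT) : 0 < T.size := by
  cases T <;> simp [FBT.size]

theorem cdiv_eq (a m : ℕ) (ha : 0 < a) (hm : 0 < m) : cdiv a m = (a - 1) / m + 1 := by
  unfold cdiv
  rw [show a + m - 1 = (a - 1) + m by omega, Nat.add_div_right _ hm]

theorem div_add_div_le' (a b c m : ℕ) (hm : 0 < m) (h : a + b ≤ c) : a / m + b / m ≤ c / m := by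
  rw [Nat.le_div_iff_mul_le hm, add_mul]
  have := Nat.div_mul_le_self a m
  have := Nat.div_mul_le_self b m
  omega

/-- The inductive invariant. -/
theorem crit_inv (m : ℕ) (hm : 1 < m) (T : FBT) :
    (T.size < m → T.critCount m = 0) ∧
    (m ≤ T.size → T.critCount m + 1 ≤ (T.size - 1) / m + T.size / m) := by
  induction T with
  | leaf => simp [FBT.size, FBT.critCount]; omega
  | node l r ihl ihr =>
    obtain ⟨l1, l2⟩ := ihl
    obtain ⟨r1, r2⟩ := ihr
    have hl := l.size_pos
    have hr := r.size_pos
    have hs : (FBT.node l r).size = 1 + l.size + r.size := rfl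
    have hp := (FBT.node l r).size_pos
    have hc : (FBT.node l r).critCount m = (if cdiv (FBT.node l r).size m ≠ cdiv l.size m ∧
          cdiv (FBT.node l r).size m ≠ cdiv r.size m then 1 else 0)
        + l.critCount m + r.critCount m := rfl
    have m0 : 0 < m := by omega
    rw [cdiv_eq _ _ hp m0, cdiv_eq _ _ hl m0, cdiv_eq _ _ hr m0] at hc
    generalize (FBT.node l r).critCount m = c at *
    generalize (FBT.node l r).size = n at *
    generalize l.critCount m = cl at *
    generalize r.critCount m = cr at *
    generalize l.size = x at *
    generalize r.size = y at *
    have a1 := div_add_div_le' (x - 1) (y - 1) (n - 1) m m0 (by omega)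
    have a2 := div_add_div_le' x y n m m0 (by omega)
    constructor
    · intro h
      have e1 : (n - 1) / m = 0 := Nat.div_eq_of_lt (by omega)
      have e2 : (x - 1) / m = 0 := Nat.div_eq_of_lt (by omega)
      rw [e1, e2] at hc
      have := l1 (by omega)
      have := r1 (by omega)
      simp at hc
      omega
    · intro h
      have e0 : 1 ≤ n / m := (Nat.le_div_iff_mul_le m0).2 (by omega)
      generalize (n - 1) / m = A at *
      generalize (x - 1) / m = B at *
      generalize (y - 1) / m = C at *
      generalize n / m = D at *
      generalize x / m = E at *
      generalize y / m = F at *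
      rcases Nat.lt_or_ge x m with hx | hx <;> rcases Nat.lt_or_ge y m with hy | hy <;>
        split_ifs at hc <;> simp_all <;> omega

/-- Let `T` be a full binary tree with `n` nodes and let `1 < m ≤ n`.  Then the
number of `m`-critical nodes of `T` is at most `2n/m − 1`. -/
theorem stmt11 (T : FBT) (n m : ℕ) (hn : n = T.size) (h1 : 1 < m) (h2 : m ≤ n) :
    (T.critCount m : ℝ) ≤ 2 * n / m - 1 := by
  have h := (crit_inv m h1 T).2 (hn ▸ h2)
  rw [← hn] at h
  have hm : (0 : ℝ) < m := by exact_mod_cast (by omega : 0 < m)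
  have a : (n - 1) / m ≤ n / m := Nat.div_le_div_right (by omega)
  have b := Nat.div_mul_le_self n m
  have h3 : (T.critCount m + 1) * m ≤ 2 * n := by nlinarith
  have h4 : ((T.critCount m : ℝ) + 1) * m ≤ 2 * n := by exact_mod_cast h3
  rw [le_sub_iff_add_le, le_div_iff₀ hm]
  exact h4
end

section
/- Kleene-algebra denesting identity for languages: for all languages α, β, γ, δ over an alphabet, (α·β∗·γ ∪ δ)∗ = δ∗·α·(β ∪ γ·δ∗·α)∗·γ·δ∗ ∪ δ∗. -/
open Computability

theorem denest_aux {K : Type*} [KleeneAlgebra K] (a b c d : K) :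
    (a * b∗ * c + d)∗ = d∗ * a * (b + c * d∗ * a)∗ * c * d∗ + d∗ := by
  have one_mul_le : ∀ x y : K, 1 ≤ x → y ≤ x * y := fun x y h => by
    calc y = 1 * y := (one_mul y).symm
      _ ≤ x * y := mul_le_mul_left h y
  have le_mul_one : ∀ x y : K, 1 ≤ x → y ≤ y * x := fun x y h => by
    calc y = y * 1 := (mul_one y).symm
      _ ≤ y * x := mul_le_mul_right h y
  have hl : ∀ x y : K, x ≤ x + y := fun x y => by simp
  have hr : ∀ x y : K, y ≤ x + y := fun x y => by simp
  apply le_antisymm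
  · set M := (b + c * d∗ * a)∗ with hM
    have hbM : b∗ ≤ M := kstar_mono (hl _ _)
    have hcM : c * d∗ * a ≤ M := (hr _ _).trans le_kstar
    have hMM : M * M = M := kstar_mul_kstar _
    have hdd : d * d∗ ≤ d∗ := mul_kstar_le_kstar
    have h1 : (1 : K) ≤ d∗ := one_le_kstar
    have key : ∀ x : K, a * x ≤ d∗ * a * x := fun x => by
      rw [mul_assoc]; exact one_mul_le _ _ h1
    apply kstar_le_of_mul_le_right (h1.trans (hr _ _))
    rw [add_mul, mul_add, mul_add]
    refine add_le (add_le ?_ ?_) (add_le ?_ ?_)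
    · refine le_trans ?_ (hl _ _)
      calc a * b∗ * c * (d∗ * a * M * c * d∗)
          = a * (b∗ * (c * d∗ * a) * M * c * d∗) := by simp only [mul_assoc]
        _ ≤ a * (M * M * M * c * d∗) := by gcongr
        _ = a * (M * c * d∗) := by rw [hMM, hMM]
        _ ≤ d∗ * a * (M * c * d∗) := key _
        _ = _ := by simp only [mul_assoc]
    · refine le_trans ?_ (hl _ _)
      calc a * b∗ * c * d∗ = a * (b∗ * c * d∗) := by simp only [mul_assoc]
        _ ≤ a * (M * c * d∗) := by gcongr
        _ ≤ d∗ * a * (M * c * d∗) := key _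
        _ = _ := by simp only [mul_assoc]
    · refine le_trans ?_ (hl _ _)
      calc d * (d∗ * a * M * c * d∗) = (d * d∗) * a * M * c * d∗ := by simp only [mul_assoc]
        _ ≤ _ := by gcongr
    · exact hdd.trans (hr _ _)
  · set L := (a * b∗ * c + d)∗ with hL
    have hdL : d∗ ≤ L := kstar_mono (hr _ _)
    have haL : a * b∗ * c ≤ L := (hl _ _).trans le_kstar
    have hLL : L * L = L := kstar_mul_kstar _
    have h1 : (1 : K) ≤ L := one_le_kstar
    have hM : (b + c * d∗ * a)∗ * c ≤ b∗ * c * L := by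
      apply kstar_mul_le
      · exact (one_mul_le _ _ one_le_kstar).trans (le_mul_one _ _ h1)
      · rw [add_mul]
        refine add_le ?_ ?_
        · calc b * (b∗ * c * L) = (b * b∗) * c * L := by simp only [mul_assoc]
            _ ≤ b∗ * c * L := by gcongr; exact mul_kstar_le_kstar
        · calc c * d∗ * a * (b∗ * c * L) = c * (d∗ * (a * b∗ * c) * L) := by
                simp only [mul_assoc]
            _ ≤ c * (L * L * L) := by gcongr
            _ = c * L := by rw [hLL, hLL]
            _ ≤ b∗ * (c * L) := one_mul_le _ _ one_le_kstar
            _ = _ := by simp only [mul_assoc]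
    refine add_le ?_ hdL
    calc d∗ * a * (b + c * d∗ * a)∗ * c * d∗
        = d∗ * a * ((b + c * d∗ * a)∗ * c) * d∗ := by simp only [mul_assoc]
      _ ≤ d∗ * a * (b∗ * c * L) * d∗ := by gcongr
      _ = d∗ * (a * b∗ * c) * L * d∗ := by simp only [mul_assoc]
      _ ≤ L * L * L * L := by gcongr
      _ = L := by rw [hLL, hLL, hLL]

/-- **Kleene-algebra denesting identity for languages**: for all languages
`α, β, γ, δ` over an alphabet,
`(α·β∗·γ ∪ δ)∗ = δ∗·α·(β ∪ γ·δ∗·α)∗·γ·δ∗ ∪ δ∗`. -/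
theorem stmt13 (A : Type*) (α β γ δ : Language A) :
    (α * β∗ * γ + δ)∗ = δ∗ * α * (β + γ * δ∗ * α)∗ * γ * δ∗ + δ∗ := by
  exact denest_aux α β γ δ
end

section
/- The maps on languages of the form X ↦ α·(a·X·b ∪ c)∗·γ ∪ δ are closed under pointwise Kleene star: for all languages a, b, c, α, γ, δ over an alphabet and every language X, (α·(a·X·b ∪ c)∗·γ ∪ δ)∗ = δ∗·α·(a·X·b ∪ (c ∪ γ·δ∗·α))∗·γ·δ∗ ∪ δ∗. -/
open Computability

theorem aux14 {K : Type*} [KleeneAlgebra K] (p α γ δ : K) :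
    (α * p∗ * γ + δ)∗ = δ∗ * α * (p + γ * δ∗ * α)∗ * γ * δ∗ + δ∗ := by
  have l1 : ∀ x y : K, x ≤ x + y := fun x y => by rw [add_eq_sup]; exact le_sup_left
  have l2 : ∀ x y : K, y ≤ x + y := fun x y => by rw [add_eq_sup]; exact le_sup_right
  have hd1 : 1 ≤ δ∗ := one_le_kstar
  apply le_antisymm
  · generalize hM : (p + γ * δ∗ * α)∗ = M
    have hp : p∗ ≤ M := hM ▸ kstar_mono (l1 _ _)
    have hg : γ * δ∗ * α ≤ M := hM ▸ (l2 _ _).trans le_kstar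
    have hMM : M * M = M := by rw [← hM]; exact kstar_mul_kstar _
    have hαM : α * M * γ * δ∗ ≤ δ∗ * α * M * γ * δ∗ := by
      calc α * M * γ * δ∗ = 1 * α * M * γ * δ∗ := by rw [one_mul]
        _ ≤ _ := by gcongr
    apply kstar_le_of_mul_le_right
    · exact hd1.trans (l2 _ _)
    · rw [add_mul, mul_add, mul_add]
      refine add_le (add_le ?_ ?_) (add_le ?_ ?_)
      · refine le_trans ?_ (l1 _ _)
        refine le_trans ?_ hαM
        calc α * p∗ * γ * (δ∗ * α * M * γ * δ∗)
            = α * (p∗ * (γ * δ∗ * α) * M) * γ * δ∗ := by simp only [mul_assoc]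
          _ ≤ α * (M * M * M) * γ * δ∗ := by gcongr
          _ = _ := by rw [hMM, hMM]
      · refine le_trans ?_ (l1 _ _)
        refine le_trans ?_ hαM
        gcongr
      · refine le_trans ?_ (l1 _ _)
        calc δ * (δ∗ * α * M * γ * δ∗) = (δ * δ∗) * α * M * γ * δ∗ := by
              simp only [mul_assoc]
          _ ≤ _ := by
              have := mul_kstar_le_kstar (a := δ)
              gcongr
      · exact mul_kstar_le_kstar.trans (l2 _ _)
  · generalize hS : (α * p∗ * γ + δ)∗ = S
    have hd : δ∗ ≤ S := hS ▸ kstar_mono (l2 _ _)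
    have hα : α * p∗ * γ ≤ S := hS ▸ (l1 _ _).trans le_kstar
    have hSS : S * S = S := by rw [← hS]; exact kstar_mul_kstar _
    have hp1 : 1 ≤ p∗ := one_le_kstar
    have hpp : p * p∗ ≤ p∗ := mul_kstar_le_kstar
    have hup : γ * S * α * p∗ ≤ p∗ * γ * S * α * p∗ := by
      calc γ * S * α * p∗ = 1 * γ * S * α * p∗ := by rw [one_mul]
        _ ≤ _ := by gcongr
    have hT : (p + γ * δ∗ * α)∗ ≤ p∗ + p∗ * γ * S * α * p∗ := by
      apply kstar_le_of_mul_le_right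
      · exact hp1.trans (l1 _ _)
      · rw [add_mul, mul_add, mul_add]
        refine add_le (add_le ?_ ?_) (add_le ?_ ?_)
        · exact hpp.trans (l1 _ _)
        · refine le_trans ?_ (l2 _ _)
          calc p * (p∗ * γ * S * α * p∗) = (p * p∗) * γ * S * α * p∗ := by
                simp only [mul_assoc]
            _ ≤ _ := by gcongr
        · refine le_trans ?_ (l2 _ _)
          refine le_trans ?_ hup
          gcongr
        · refine le_trans ?_ (l2 _ _)
          refine le_trans ?_ hup
          calc γ * δ∗ * α * (p∗ * γ * S * α * p∗)
              = γ * (δ∗ * (α * p∗ * γ) * S) * α * p∗ := by simp only [mul_assoc]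
            _ ≤ γ * (S * S * S) * α * p∗ := by gcongr
            _ = _ := by rw [hSS, hSS]
    have hαT : α * (p + γ * δ∗ * α)∗ * γ ≤ S := by
      calc α * (p + γ * δ∗ * α)∗ * γ ≤ α * (p∗ + p∗ * γ * S * α * p∗) * γ := by gcongr
        _ = α * p∗ * γ + (α * p∗ * γ) * S * (α * p∗ * γ) := by
            simp only [mul_add, add_mul, mul_assoc]
        _ ≤ S + S * S * S := by gcongr
        _ = S := by rw [hSS, hSS, add_idem]
    refine add_le ?_ hd
    calc δ∗ * α * (p + γ * δ∗ * α)∗ * γ * δ∗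
        = δ∗ * (α * (p + γ * δ∗ * α)∗ * γ) * δ∗ := by simp only [mul_assoc]
      _ ≤ S * S * S := by gcongr
      _ = S := by rw [hSS, hSS]

/-- The maps on languages of the form `X ↦ α·(a·X·b ∪ c)∗·γ ∪ δ` are closed under
pointwise Kleene star: for all languages `a, b, c, α, γ, δ` over an alphabet and
every language `X`,
`(α·(a·X·b ∪ c)∗·γ ∪ δ)∗ = δ∗·α·(a·X·b ∪ (c ∪ γ·δ∗·α))∗·γ·δ∗ ∪ δ∗`. -/
theorem stmt14 (A : Type*) (a b c α γ δ : Language A) (X : Language A) :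
    (α * (a * X * b + c)∗ * γ + δ)∗ =
      δ∗ * α * (a * X * b + (c + γ * δ∗ * α))∗ * γ * δ∗ + δ∗ := by
  rw [← add_assoc]
  exact aux14 (a * X * b + c) α γ δ
end

section
/- The maps on languages of the form X ↦ α·(a·X·b ∪ c)∗·γ ∪ δ are closed under composition; explicitly, for all languages a₁,b₁,c₁,α₁,γ₁,δ₁ and a₂,b₂,c₂,α₂,γ₂,δ₂ over an alphabet, setting α' = a₂·α₁, γ' = γ₁·b₂ and δ' = a₂·δ₁·b₂ ∪ c₂, the identity α₂·(a₂·(α₁·(a₁·X·b₁ ∪ c₁)∗·γ₁ ∪ δ₁)·b₂ ∪ c₂)∗·γ₂ ∪ δ₂ = (α₂·δ'∗·α')·(a₁·X·b₁ ∪ (c₁ ∪ γ'·δ'∗·α'))∗·(γ'·δ'∗·γ₂) ∪ (α₂·δ'∗·γ₂ ∪ δ₂) holds for every language X. -/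
open Computability

theorem kleene_core {K : Type*} [KleeneAlgebra K] (p y q d : K) :
    (p * y∗ * q + d)∗ = d∗ + d∗ * p * (y + q * d∗ * p)∗ * q * d∗ := by
  apply le_antisymm
  · have hy : y∗ ≤ (y + q * d∗ * p)∗ := kstar_mono (le_add_of_nonneg_right zero_le)
    have hr : q * d∗ * p ≤ (y + q * d∗ * p)∗ :=
      le_trans (le_add_of_nonneg_left zero_le) le_kstar
    have hZ : (y + q * d∗ * p)∗ * (y + q * d∗ * p)∗ = (y + q * d∗ * p)∗ := kstar_mul_kstar _
    have h1 : (1 : K) ≤ d∗ := one_le_kstar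
    have hd : d * d∗ ≤ d∗ := mul_kstar_le_kstar
    generalize (y + q * d∗ * p)∗ = Z at *
    generalize d∗ = D at *
    apply kstar_le_of_mul_le_right
    · exact le_trans h1 (le_add_of_nonneg_right zero_le)
    · have e1 : d * D ≤ D + D * p * Z * q * D := hd.trans (le_add_of_nonneg_right zero_le)
      have key : p * Z * q * D ≤ D + D * p * Z * q * D := by
        refine le_trans ?_ (le_add_of_nonneg_left zero_le)
        calc p * Z * q * D = 1 * p * Z * q * D := by rw [one_mul]
          _ ≤ _ := by gcongr
      have e2 : d * (D * p * Z * q * D) ≤ D + D * p * Z * q * D := by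
        refine le_trans ?_ (le_add_of_nonneg_left zero_le)
        calc d * (D * p * Z * q * D) = d * D * p * Z * q * D := by simp only [mul_assoc]
          _ ≤ _ := by gcongr
      have e3 : p * y∗ * q * D ≤ D + D * p * Z * q * D := by
        refine le_trans ?_ key
        gcongr
      have e4 : p * y∗ * q * (D * p * Z * q * D) ≤ D + D * p * Z * q * D := by
        refine le_trans ?_ key
        calc p * y∗ * q * (D * p * Z * q * D) = p * (y∗ * (q * D * p) * Z) * q * D := by
              simp only [mul_assoc]
          _ ≤ p * (Z * Z * Z) * q * D := by gcongr
          _ = _ := by rw [hZ, hZ]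
      rw [add_mul, mul_add, mul_add]
      exact add_le (add_le e3 e4) (add_le e1 e2)
  · have hD : d∗ ≤ (p * y∗ * q + d)∗ := kstar_mono (le_add_of_nonneg_left zero_le)
    have hp : p * y∗ * q ≤ (p * y∗ * q + d)∗ :=
      le_trans (le_add_of_nonneg_right zero_le) le_kstar
    have hL : (p * y∗ * q + d)∗ * (p * y∗ * q + d)∗ = (p * y∗ * q + d)∗ := kstar_mul_kstar _
    have h1 : (1 : K) ≤ y∗ := one_le_kstar
    have hy : y * y∗ ≤ y∗ := mul_kstar_le_kstar
    generalize (p * y∗ * q + d)∗ = L at *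
    have hZ : (y + q * d∗ * p)∗ * (q * d∗) ≤ y∗ * q * L := by
      have key : q * L ≤ y∗ * q * L := by
        calc q * L = 1 * q * L := by rw [one_mul]
          _ ≤ _ := by gcongr
      apply kstar_mul_le
      · refine le_trans ?_ key
        gcongr
      · rw [add_mul]
        refine add_le ?_ ?_
        · calc y * (y∗ * q * L) = y * y∗ * q * L := by simp only [mul_assoc]
            _ ≤ _ := by gcongr
        · refine le_trans ?_ key
          calc q * d∗ * p * (y∗ * q * L) = q * (d∗ * (p * y∗ * q) * L) := by
                simp only [mul_assoc]
            _ ≤ q * (L * L * L) := by gcongr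
            _ = _ := by rw [hL, hL]
    refine add_le hD ?_
    calc d∗ * p * (y + q * d∗ * p)∗ * q * d∗ = d∗ * p * ((y + q * d∗ * p)∗ * (q * d∗)) := by
          simp only [mul_assoc]
      _ ≤ d∗ * p * (y∗ * q * L) := by gcongr
      _ = d∗ * (p * y∗ * q) * L := by simp only [mul_assoc]
      _ ≤ L * L * L := by gcongr
      _ = L := by rw [hL, hL]

/-- The maps on languages of the form `X ↦ α·(a·X·b ∪ c)∗·γ ∪ δ` are closed under
composition; explicitly, for all languages `a₁,b₁,c₁,α₁,γ₁,δ₁` and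
`a₂,b₂,c₂,α₂,γ₂,δ₂` over an alphabet, setting `α' = a₂·α₁`, `γ' = γ₁·b₂` and
`δ' = a₂·δ₁·b₂ ∪ c₂`, the identity
`α₂·(a₂·(α₁·(a₁·X·b₁ ∪ c₁)∗·γ₁ ∪ δ₁)·b₂ ∪ c₂)∗·γ₂ ∪ δ₂
  = (α₂·δ'∗·α')·(a₁·X·b₁ ∪ (c₁ ∪ γ'·δ'∗·α'))∗·(γ'·δ'∗·γ₂) ∪ (α₂·δ'∗·γ₂ ∪ δ₂)`
holds for every language `X`. -/
theorem stmt15 (A : Type*) (a₁ b₁ c₁ α₁ γ₁ δ₁ a₂ b₂ c₂ α₂ γ₂ δ₂ : Language A)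
    (α' γ' δ' : Language A)
    (hα' : α' = a₂ * α₁) (hγ' : γ' = γ₁ * b₂) (hδ' : δ' = a₂ * δ₁ * b₂ + c₂)
    (X : Language A) :
    α₂ * (a₂ * (α₁ * (a₁ * X * b₁ + c₁)∗ * γ₁ + δ₁) * b₂ + c₂)∗ * γ₂ + δ₂ =
      (α₂ * δ'∗ * α') * (a₁ * X * b₁ + (c₁ + γ' * δ'∗ * α'))∗ * (γ' * δ'∗ * γ₂)
        + (α₂ * δ'∗ * γ₂ + δ₂) := by
  have h : a₂ * (α₁ * (a₁ * X * b₁ + c₁)∗ * γ₁ + δ₁) * b₂ + c₂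
      = α' * (a₁ * X * b₁ + c₁)∗ * γ' + δ' := by
    rw [hα', hγ', hδ']
    simp only [mul_add, add_mul, mul_assoc, add_assoc]
  rw [h, kleene_core, ← add_assoc (a₁ * X * b₁), mul_add, add_mul, ← add_assoc,
    add_comm (α₂ * δ'∗ * γ₂)]
  simp only [mul_assoc]
end

section
/- Classification of linear term functions over regular languages: let Σ be a finite alphabet and let t be a context over the signature of regular expressions (a regular expression built from ∅, ε, letters a ∈ Σ, union, concatenation and Kleene star, containing exactly one occurrence of a parameter x, where x does not occur below more than one position). If x does not occur below any ∗-operator in t, then there exist regular languages a, b, c over Σ such that the function induced by t on languages satisfies t(X) = a·X·b ∪ c for every language X; otherwise there exist regular languages a, b, c, α, γ, δ over Σ such that t(X) = α·(a·X·b ∪ c)∗·γ ∪ δ for every language X. -/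
open Computability

/-- A regular expression over `α` with an additional parameter symbol `x`. -/
inductive RECtx (α : Type) : Type
  | param : RECtx α
  | zero : RECtx α
  | epsilon : RECtx α
  | char : α → RECtx α
  | plus : RECtx α → RECtx α → RECtx α
  | comp : RECtx α → RECtx α → RECtx α
  | star : RECtx α → RECtx α

/-- The number of occurrences of the parameter `x`. -/
def RECtx.holes {α : Type} : RECtx α → ℕ
  | .param => 1
  | .zero => 0
  | .epsilon => 0
  | .char _ => 0
  | .plus p q => p.holes + q.holes
  | .comp p q => p.holes + q.holes
  | .star p => p.holes

/-- `t.underStar` holds iff some occurrence of the parameter `x` lies below a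
`∗`-operator in `t`. -/
def RECtx.underStar {α : Type} : RECtx α → Prop
  | .param => False
  | .zero => False
  | .epsilon => False
  | .char _ => False
  | .plus p q => p.underStar ∨ q.underStar
  | .comp p q => p.underStar ∨ q.underStar
  | .star p => p.holes ≠ 0 ∨ p.underStar

/-- The function on languages induced by a context: interpret `x` as `X` and
evaluate (`∅` as the empty language, `ε` as `{ε}`, `a` as `{[a]}`, `+` as union,
`·` as concatenation, `∗` as Kleene star). -/
def RECtx.eval {α : Type} (X : Language α) : RECtx α → Language α
  | .param => X
  | .zero => 0
  | .epsilon => 1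
  | .char a => {[a]}
  | .plus p q => p.eval X + q.eval X
  | .comp p q => p.eval X * q.eval X
  | .star p => (p.eval X)∗

/-- A language is regular if it is denoted by some regular expression. -/
def IsRegularLang {α : Type} (L : Language α) : Prop :=
  ∃ e : RegularExpression α, e.matches' = L

section Helpers

theorem ka_left {K : Type*} [KleeneAlgebra K] (a b : K) : a ≤ a + b := by
  rw [add_eq_sup]; exact le_sup_left

theorem ka_right {K : Type*} [KleeneAlgebra K] (a b : K) : b ≤ a + b := by
  rw [add_eq_sup]; exact le_sup_right

theorem ka_star_aux {K : Type*} [KleeneAlgebra K] (p M g d : K) :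
    (p * M∗ * g + d)∗ = (d∗ * p) * (M + g * d∗ * p)∗ * (g * d∗) + d∗ := by
  set N := g * d∗ * p with hN
  apply le_antisymm
  · apply kstar_le_of_mul_le_left
    · refine le_trans (one_le_kstar (a := d)) ?_
      exact ka_right _ _
    · have hd : d∗ * d ≤ d∗ := kstar_mul_le_kstar
      have hM : M∗ ≤ (M + N)∗ := kstar_mono (by exact ka_left _ _)
      have hNs : N ≤ (M + N)∗ :=
        le_trans (by exact ka_right _ _) le_kstar
      have e : ((d∗ * p) * (M + N)∗ * (g * d∗) + d∗) * (p * M∗ * g + d)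
          = (d∗ * p) * ((M + N)∗ * N * M∗) * g * 1 + (d∗ * p) * (M + N)∗ * (g * (d∗ * d))
            + (d∗ * p * M∗ * g * 1 + d∗ * d) := by
        simp only [hN, mul_add, add_mul, mul_assoc, mul_one]
        abel
      rw [e]
      have h1 : (M + N)∗ * N * M∗ ≤ (M + N)∗ := by
        calc (M + N)∗ * N * M∗ ≤ (M + N)∗ * (M + N)∗ * (M + N)∗ := by gcongr
          _ = _ := by simp
      have hone : (1 : K) ≤ d∗ := one_le_kstar
      have hT : (d∗ * p) * (M + N)∗ * (g * d∗) ≤ (d∗ * p) * (M + N)∗ * (g * d∗) + d∗ := by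
        exact ka_left _ _
      have hD : d∗ ≤ (d∗ * p) * (M + N)∗ * (g * d∗) + d∗ := by
        exact ka_right _ _
      refine add_le (add_le ?_ ?_) (add_le ?_ ?_)
      · refine le_trans ?_ hT
        calc _ ≤ (d∗ * p) * (M + N)∗ * g * d∗ := by gcongr
          _ = _ := by simp only [mul_assoc]
      · refine le_trans ?_ hT
        gcongr
      · refine le_trans ?_ hT
        calc _ ≤ (d∗ * p) * (M + N)∗ * g * d∗ := by gcongr
          _ = _ := by simp only [mul_assoc]
      · exact hd.trans hD
  · set S := (p * M∗ * g + d)∗ with hS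
    have hd : d∗ ≤ S := kstar_mono (by exact ka_right _ _)
    have hp : p * M∗ * g ≤ S := le_trans (by exact ka_left _ _) le_kstar
    have hSS : S * S = S := by simp [hS]
    have hone : (1 : K) ≤ M∗ := one_le_kstar
    have inv : (S * p * M∗) * (M + N) ≤ S * p * M∗ := by
      rw [mul_add]
      refine add_le ?_ ?_
      · rw [mul_assoc (S * p)]
        gcongr
        exact kstar_mul_le_kstar
      · calc S * p * M∗ * N = S * (p * M∗ * g) * d∗ * p * 1 := by
              simp only [hN, mul_assoc, mul_one]
          _ ≤ S * S * S * p * M∗ := by gcongr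
          _ = _ := by rw [hSS, hSS]
    have inv2 : (S * p * M∗) * (M + N)∗ ≤ S * p * M∗ := mul_kstar_le_self inv
    refine add_le ?_ hd
    calc (d∗ * p) * (M + N)∗ * (g * d∗) = (d∗ * p * 1) * (M + N)∗ * (g * d∗) := by rw [mul_one]
      _ ≤ (S * p * M∗) * (M + N)∗ * (g * S) := by gcongr
      _ ≤ (S * p * M∗) * (g * S) := by gcongr
      _ = S * (p * M∗ * g) * S := by simp only [mul_assoc]
      _ ≤ S * S * S := by gcongr
      _ = S := by rw [hSS, hSS]

variable {α : Type}

theorem IsRegularLang.zero : IsRegularLang (0 : Language α) := ⟨0, rfl⟩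
theorem IsRegularLang.one : IsRegularLang (1 : Language α) := ⟨1, rfl⟩
theorem IsRegularLang.char (a : α) : IsRegularLang ({[a]} : Language α) := ⟨.char a, rfl⟩
theorem IsRegularLang.add {L M : Language α} :
    IsRegularLang L → IsRegularLang M → IsRegularLang (L + M) := by
  rintro ⟨e, rfl⟩ ⟨f, rfl⟩; exact ⟨e + f, rfl⟩
theorem IsRegularLang.mul {L M : Language α} :
    IsRegularLang L → IsRegularLang M → IsRegularLang (L * M) := by
  rintro ⟨e, rfl⟩ ⟨f, rfl⟩; exact ⟨e * f, rfl⟩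
theorem IsRegularLang.star {L : Language α} : IsRegularLang L → IsRegularLang (L∗) := by
  rintro ⟨e, rfl⟩; exact ⟨.star e, rfl⟩

theorem RECtx.const (t : RECtx α) (ht : t.holes = 0) :
    ¬ t.underStar ∧ ∃ L : Language α, IsRegularLang L ∧ ∀ X, t.eval X = L := by
  induction t with
  | param => simp [RECtx.holes] at ht
  | zero => exact ⟨id, 0, .zero, fun _ => rfl⟩
  | epsilon => exact ⟨id, 1, .one, fun _ => rfl⟩
  | char a => exact ⟨id, _, .char a, fun _ => rfl⟩
  | plus p q hp hq =>
    simp only [RECtx.holes, Nat.add_eq_zero_iff] at ht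
    obtain ⟨u, L, hL, h⟩ := hp ht.1
    obtain ⟨v, M, hM, k⟩ := hq ht.2
    exact ⟨by simp [RECtx.underStar, u, v], _, hL.add hM, fun X => by simp [RECtx.eval, h, k]⟩
  | comp p q hp hq =>
    simp only [RECtx.holes, Nat.add_eq_zero_iff] at ht
    obtain ⟨u, L, hL, h⟩ := hp ht.1
    obtain ⟨v, M, hM, k⟩ := hq ht.2
    exact ⟨by simp [RECtx.underStar, u, v], _, hL.mul hM, fun X => by simp [RECtx.eval, h, k]⟩
  | star p hp =>
    simp only [RECtx.holes] at ht
    obtain ⟨u, L, hL, h⟩ := hp ht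
    exact ⟨by simp [RECtx.underStar, u, ht], _, hL.star, fun X => by simp [RECtx.eval, h]⟩

end Helpers

/-- **Classification of linear term functions over regular languages**: let `Σ` be
a finite alphabet and `t` a regular-expression context with exactly one occurrence
of the parameter `x`.  If `x` does not occur below any `∗`-operator in `t`, then
there are regular languages `a, b, c` with `t(X) = a·X·b ∪ c` for every language
`X`; otherwise there are regular languages `a, b, c, α, γ, δ` with
`t(X) = α·(a·X·b ∪ c)∗·γ ∪ δ` for every language `X`. -/
theorem stmt16 (α : Type) [Fintype α] (t : RECtx α) (ht : t.holes = 1) :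
    (¬ t.underStar →
      ∃ a b c : Language α, IsRegularLang a ∧ IsRegularLang b ∧ IsRegularLang c ∧
        ∀ X : Language α, t.eval X = a * X * b + c) ∧
    (t.underStar →
      ∃ a b c α' γ δ : Language α,
        IsRegularLang a ∧ IsRegularLang b ∧ IsRegularLang c ∧
        IsRegularLang α' ∧ IsRegularLang γ ∧ IsRegularLang δ ∧
        ∀ X : Language α, t.eval X = α' * (a * X * b + c)∗ * γ + δ) := by
  induction t with
  | param =>
    refine ⟨fun _ => ⟨1, 1, 0, .one, .one, .zero, fun X => by simp [RECtx.eval]⟩, fun h => h.elim⟩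
  | zero => simp [RECtx.holes] at ht
  | epsilon => simp [RECtx.holes] at ht
  | char a => simp [RECtx.holes] at ht
  | plus p q hp hq =>
    simp only [RECtx.holes] at ht
    rcases (by omega : (p.holes = 1 ∧ q.holes = 0) ∨ (p.holes = 0 ∧ q.holes = 1)) with
      ⟨h1, h0⟩ | ⟨h0, h1⟩
    · obtain ⟨u, L, hL, hv⟩ := q.const h0
      obtain ⟨A, B⟩ := hp h1
      simp only [RECtx.underStar, u, or_false, RECtx.eval, hv]
      refine ⟨fun h => ?_, fun h => ?_⟩
      · obtain ⟨a, b, c, ha, hb, hc, e⟩ := A h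
        exact ⟨a, b, c + L, ha, hb, hc.add hL, fun X => by rw [e, add_assoc]⟩
      · obtain ⟨a, b, c, x, y, z, ha, hb, hc, hx, hy, hz, e⟩ := B h
        exact ⟨a, b, c, x, y, z + L, ha, hb, hc, hx, hy, hz.add hL,
          fun X => by rw [e, add_assoc]⟩
    · obtain ⟨u, L, hL, hv⟩ := p.const h0
      obtain ⟨A, B⟩ := hq h1
      simp only [RECtx.underStar, u, false_or, RECtx.eval, hv]
      refine ⟨fun h => ?_, fun h => ?_⟩
      · obtain ⟨a, b, c, ha, hb, hc, e⟩ := A h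
        exact ⟨a, b, L + c, ha, hb, hL.add hc, fun X => by rw [e, add_left_comm]⟩
      · obtain ⟨a, b, c, x, y, z, ha, hb, hc, hx, hy, hz, e⟩ := B h
        exact ⟨a, b, c, x, y, L + z, ha, hb, hc, hx, hy, hL.add hz,
          fun X => by rw [e, add_left_comm]⟩
  | comp p q hp hq =>
    simp only [RECtx.holes] at ht
    rcases (by omega : (p.holes = 1 ∧ q.holes = 0) ∨ (p.holes = 0 ∧ q.holes = 1)) with
      ⟨h1, h0⟩ | ⟨h0, h1⟩
    · obtain ⟨u, L, hL, hv⟩ := q.const h0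
      obtain ⟨A, B⟩ := hp h1
      simp only [RECtx.underStar, u, or_false, RECtx.eval, hv]
      refine ⟨fun h => ?_, fun h => ?_⟩
      · obtain ⟨a, b, c, ha, hb, hc, e⟩ := A h
        exact ⟨a, b * L, c * L, ha, hb.mul hL, hc.mul hL,
          fun X => by rw [e, add_mul, mul_assoc (a * X)]⟩
      · obtain ⟨a, b, c, x, y, z, ha, hb, hc, hx, hy, hz, e⟩ := B h
        exact ⟨a, b, c, x, y * L, z * L, ha, hb, hc, hx, hy.mul hL, hz.mul hL,
          fun X => by rw [e, add_mul, mul_assoc (x * _)]⟩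
    · obtain ⟨u, L, hL, hv⟩ := p.const h0
      obtain ⟨A, B⟩ := hq h1
      simp only [RECtx.underStar, u, false_or, RECtx.eval, hv]
      refine ⟨fun h => ?_, fun h => ?_⟩
      · obtain ⟨a, b, c, ha, hb, hc, e⟩ := A h
        exact ⟨L * a, b, L * c, hL.mul ha, hb, hL.mul hc,
          fun X => by rw [e, mul_add]; simp only [mul_assoc]⟩
      · obtain ⟨a, b, c, x, y, z, ha, hb, hc, hx, hy, hz, e⟩ := B h
        exact ⟨a, b, c, L * x, y, L * z, ha, hb, hc, hL.mul hx, hy, hL.mul hz,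
          fun X => by rw [e, mul_add, ← mul_assoc, ← mul_assoc]⟩
  | star p hp =>
    simp only [RECtx.holes] at ht
    obtain ⟨A, B⟩ := hp ht
    refine ⟨fun h => ?_, fun _ => ?_⟩
    · simp [RECtx.underStar, ht] at h
    · by_cases h : p.underStar
      · obtain ⟨a, b, c, x, y, z, ha, hb, hc, hx, hy, hz, e⟩ := B h
        refine ⟨a, b, c + y * z∗ * x, z∗ * x, y * z∗, z∗, ha, hb,
          hc.add ((hy.mul hz.star).mul hx), hz.star.mul hx, hy.mul hz.star, hz.star,
          fun X => ?_⟩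
        rw [RECtx.eval, e, ka_star_aux, add_assoc]
      · obtain ⟨a, b, c, ha, hb, hc, e⟩ := A h
        exact ⟨a, b, c, 1, 1, 0, ha, hb, hc, .one, .one, .zero,
          fun X => by rw [RECtx.eval, e, one_mul, mul_one, add_zero]⟩
end

section
/- Simultaneous prune-and-bypass is conflict-free: let T be a full binary tree whose internal leaves are numbered 1,…,n in depth-first left-to-right order (every internal leaf has depth at least 2, so the operation is defined). If w₁ ≠ w₂ are internal leaves with odd numbers that are both left children of their parents, then the sets of edges involved in the prune-and-bypass operations at w₁ and at w₂ are disjoint; the same holds if w₁ and w₂ are both right children. Consequently, all odd-numbered internal leaves that are left children (respectively, right children) can be pruned-and-bypassed simultaneously, with no edge involved in more than one operation. -/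
/-- A finite rooted ordered tree, given by its finite, prefix-closed set of node
positions; a position is the list of child directions from the root. -/
structure PosTree (k : ℕ) where
  nodes : Finset (List (Fin k))
  root_mem : [] ∈ nodes
  prefix_closed : ∀ u v : List (Fin k), u <+: v → v ∈ nodes → u ∈ nodes

/-- A full binary tree: every node has either no children or both children. -/
def PosTree.IsFullBinary (T : PosTree 2) : Prop :=
  ∀ v ∈ T.nodes, ∀ i j : Fin 2, v ++ [i] ∈ T.nodes → v ++ [j] ∈ T.nodes

/-- A leaf of `T`. -/
def PosTree.Leaf (T : PosTree 2) (v : List (Fin 2)) : Prop :=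
  v ∈ T.nodes ∧ ∀ i : Fin 2, v ++ [i] ∉ T.nodes

/-- The depth-first left-to-right order, restricted to leaves: since two leaves
are never ancestors of one another, it is the lexicographic order on
positions. -/
def DfsLt (u v : List (Fin 2)) : Prop := List.Lex (· < ·) u v

/-- An internal leaf: a leaf which is neither the leftmost (DFS-least) nor the
rightmost (DFS-greatest) leaf of the tree. -/
def PosTree.InternalLeaf (T : PosTree 2) (v : List (Fin 2)) : Prop :=
  T.Leaf v ∧ (∃ w, T.Leaf w ∧ DfsLt w v) ∧ (∃ w, T.Leaf w ∧ DfsLt v w)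

/-- The (1-based) number of an internal leaf `w` in the depth-first
left-to-right numbering `1,…,n` of the internal leaves. -/
noncomputable def PosTree.leafNumber (T : PosTree 2) (w : List (Fin 2)) : ℕ :=
  {v | T.InternalLeaf v ∧ (DfsLt v w ∨ v = w)}.ncard

/-- The edges involved in the prune-and-bypass operation at the leaf `w = v ++ [i]`
with parent `v`, sibling `w' = v ++ [1-i]` and grandparent `u`: the edges `(u,v)`,
`(v,w)` and `(v,w')`. -/
def involvedEdges (v : List (Fin 2)) (i : Fin 2) :
    Set (List (Fin 2) × List (Fin 2)) :=
  {(v.dropLast, v), (v, v ++ [i]), (v, v ++ [1 - i])}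

theorem dfsLt_iff (u v : List (Fin 2)) : DfsLt u v ↔ u < v := Iff.rfl

theorem between_left (v x : List (Fin 2)) (h1 : v ++ [0] < x) (h2 : x < v ++ [1, 0]) :
    (∃ c t, x = v ++ [0] ++ c :: t) ∨ x = v ++ [1] := by
  induction v generalizing x with
  | nil =>
    rcases x with _ | ⟨a, _ | ⟨b, t⟩⟩
    · simp at h1
    · fin_cases a <;> simp_all
    · fin_cases a
      · left; exact ⟨b, t, rfl⟩
      · simp [List.cons_lt_cons_iff] at h2
  | cons d v ih =>
    rcases x with _ | ⟨a, x⟩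
    · simp at h1
    · simp only [List.cons_append, List.cons_lt_cons_iff] at h1 h2
      rcases h1 with h1 | ⟨rfl, h1⟩
      · rcases h2 with h2 | ⟨rfl, h2⟩
        · exact absurd h1 (lt_asymm h2)
        · exact absurd h1 (lt_irrefl _)
      · rcases h2 with h2 | ⟨_, h2⟩
        · exact absurd h2 (lt_irrefl _)
        · rcases ih x h1 h2 with ⟨c, t, rfl⟩ | rfl
          · left; exact ⟨c, t, rfl⟩
          · right; rfl

theorem between_right (v x : List (Fin 2)) (h1 : v ++ [0, 1] < x) (h2 : x < v ++ [1]) :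
    ∃ c t, x = v ++ [0, 1] ++ c :: t := by
  induction v generalizing x with
  | nil =>
    rcases x with _ | ⟨a, _ | ⟨b, _ | ⟨c, t⟩⟩⟩
    · simp at h1
    · fin_cases a <;> simp_all [List.cons_lt_cons_iff]
    · fin_cases a <;> fin_cases b <;> simp_all [List.cons_lt_cons_iff]
    · fin_cases a <;> fin_cases b <;> simp_all [List.cons_lt_cons_iff]
  | cons d v ih =>
    rcases x with _ | ⟨a, x⟩
    · simp at h1
    · simp only [List.cons_append, List.cons_lt_cons_iff] at h1 h2
      rcases h1 with h1 | ⟨rfl, h1⟩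
      · rcases h2 with h2 | ⟨rfl, h2⟩
        · exact absurd h1 (lt_asymm h2)
        · exact absurd h1 (lt_irrefl _)
      · rcases h2 with h2 | ⟨_, h2⟩
        · exact absurd h2 (lt_irrefl _)
        · obtain ⟨c, t, rfl⟩ := ih x h1 h2
          exact ⟨c, t, rfl⟩

theorem leaf_no_ext (T : PosTree 2) (v : List (Fin 2)) (hv : T.Leaf v) (c : Fin 2)
    (t : List (Fin 2)) : v ++ c :: t ∉ T.nodes := fun h =>
  hv.2 c (T.prefix_closed _ _ ⟨t, by simp⟩ h)

theorem leafNumber_succ (T : PosTree 2) (a b : List (Fin 2)) (hb : T.InternalLeaf b)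
    (hab : a < b) (hno : ∀ x, T.Leaf x → a < x → x < b → False) :
    T.leafNumber b = T.leafNumber a + 1 := by
  unfold PosTree.leafNumber
  have hs : {v | T.InternalLeaf v ∧ (DfsLt v b ∨ v = b)} =
      insert b {v | T.InternalLeaf v ∧ (DfsLt v a ∨ v = a)} := by
    ext x
    simp only [Set.mem_ofPred_eq, Set.mem_insert_iff, dfsLt_iff]
    constructor
    · rintro ⟨hx, h | h⟩
      · right
        refine ⟨hx, ?_⟩
        rcases lt_trichotomy x a with h' | h' | h'
        · exact Or.inl h'
        · exact Or.inr h'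
        · exact (hno x hx.1 h' h).elim
      · exact Or.inl h
    · rintro (rfl | ⟨hx, h | rfl⟩)
      · exact ⟨hb, Or.inr rfl⟩
      · exact ⟨hx, Or.inl (h.trans hab)⟩
      · exact ⟨hx, Or.inl hab⟩
  have hfin : {v | T.InternalLeaf v ∧ (DfsLt v a ∨ v = a)}.Finite :=
    T.nodes.finite_toSet.subset fun x hx => hx.1.1.1
  rw [hs, Set.ncard_insert_of_notMem (hs := hfin)]
  · simp only [Set.mem_ofPred_eq, dfsLt_iff]
    rintro ⟨-, h | h⟩
    · exact lt_asymm h hab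
    · exact hab.ne' h

theorem no_chain (T : PosTree 2) (i j : Fin 2) (v : List (Fin 2))
    (h₁ : T.InternalLeaf (v ++ [j] ++ [i])) (h₂ : T.InternalLeaf (v ++ [i]))
    (hodd₁ : Odd (T.leafNumber (v ++ [j] ++ [i])))
    (hodd₂ : Odd (T.leafNumber (v ++ [i]))) : False := by
  have hji : j ≠ i := by
    rintro rfl
    exact h₂.1.2 _ h₁.1.1
  have key : T.leafNumber (v ++ [j] ++ [i]) = T.leafNumber (v ++ [i]) + 1 ∨
      T.leafNumber (v ++ [i]) = T.leafNumber (v ++ [j] ++ [i]) + 1 := by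
    obtain ⟨rfl, rfl⟩ | ⟨rfl, rfl⟩ : (i = 0 ∧ j = 1) ∨ (i = 1 ∧ j = 0) := by omega
    · left
      apply leafNumber_succ T _ _ h₁
      · rw [List.append_assoc]
        exact List.append_left_lt (by simp [List.cons_lt_cons_iff])
      · intro x hx h h'
        rw [List.append_assoc] at h'
        rcases between_left v x h h' with ⟨c, t, rfl⟩ | rfl
        · exact leaf_no_ext T _ h₂.1 c t hx.1
        · exact hx.2 0 h₁.1.1
    · right
      apply leafNumber_succ T _ _ h₂
      · rw [List.append_assoc]
        exact List.append_left_lt (by simp [List.cons_lt_cons_iff])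
      · intro x hx h h'
        rw [List.append_assoc] at h
        obtain ⟨c, t, rfl⟩ := between_right v x h h'
        refine leaf_no_ext T _ h₁.1 c t ?_
        simpa using hx.1
  rcases hodd₁ with ⟨p, hp⟩
  rcases hodd₂ with ⟨q, hq⟩
  omega

/-- **Simultaneous prune-and-bypass is conflict-free**: if `w₁ ≠ w₂` are
odd-numbered internal leaves of a full binary tree that are both left children
(`i = 0`) or both right children (`i = 1`) of their parents, then the sets of
edges involved in the prune-and-bypass operations at `w₁` and at `w₂` are
disjoint.  Consequently, all odd-numbered internal leaves that are left
(respectively, right) children can be pruned-and-bypassed simultaneously, with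
no edge involved in more than one operation. -/
theorem stmt18 (T : PosTree 2) (hT : T.IsFullBinary) (i : Fin 2)
    (v₁ v₂ : List (Fin 2))
    (h₁ : T.InternalLeaf (v₁ ++ [i])) (h₂ : T.InternalLeaf (v₂ ++ [i]))
    (hne : v₁ ++ [i] ≠ v₂ ++ [i])
    (hodd₁ : Odd (T.leafNumber (v₁ ++ [i])))
    (hodd₂ : Odd (T.leafNumber (v₂ ++ [i]))) :
    Disjoint (involvedEdges v₁ i) (involvedEdges v₂ i) := by
  have hv : v₁ ≠ v₂ := fun h => hne (by rw [h])
  have c1 : ∀ j, v₁ ≠ v₂ ++ [j] := by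
    rintro j rfl
    exact no_chain T i j v₂ h₁ h₂ hodd₁ hodd₂
  have c2 : ∀ j, v₂ ≠ v₁ ++ [j] := by
    rintro j rfl
    exact no_chain T i j v₁ h₂ h₁ hodd₂ hodd₁
  rw [Set.disjoint_left]
  rintro ⟨a, b⟩ hx hy
  simp only [involvedEdges, Set.mem_insert_iff, Set.mem_singleton_iff, Prod.mk.injEq] at hx hy
  rcases hx with ⟨e1, e2⟩ | ⟨e1, e2⟩ | ⟨e1, e2⟩ <;>
  rcases hy with ⟨f1, f2⟩ | ⟨f1, f2⟩ | ⟨f1, f2⟩ <;>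
  first
  | exact hv (e2.symm.trans f2)
  | exact hv (e1.symm.trans f1)
  | exact c1 _ (e2.symm.trans f2)
  | exact c2 _ (f2.symm.trans e2)
end
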